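/- Fix y > 0 and δ ∈ (0, 1). Define Q̃₊(y, X, δ) = (1/X^δ) · Σ_{N ∈ ℤ, X ≤ N ≤ X + X^δ, N ≢ 2 (mod 4)} Σ_{χ ∈ D₊(N)} χ(⌈yX⌉^𝔭)/τ(χ) and Ẽ₊(y, X, δ) = (1/X^δ) · Σ_{N ∈ ℤ, X ≤ N ≤ X + X^δ, N ≢ 2 (mod 4)} (1/N) · Σ_{χ ∈ I₊(N)} τ(χ̄) · χ(⌈yX⌉^𝔭). Then lim_{X → ∞} (Q̃₊(y, X, δ) + Ẽ₊(y, X, δ)) = (5/π²) · cos(2πy). -/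

import Mathlib

open Filter Topology Finset

/-- `⌈x⌉^𝔭`: the smallest prime number that is `≥ x`. -/
noncomputable def leastPrime (x : ℝ) : ℕ := sInf {p : ℕ | p.Prime ∧ x ≤ (p : ℝ)}

/-- The Gauss sum `τ(χ) = Σ_{b=1}^{N} χ(b) e^{2πib/N}`. -/
noncomputable def gaussSum' {N : ℕ} (χ : DirichletCharacter ℂ N) : ℂ :=
  ∑ b ∈ Finset.Icc 1 N,
    χ ((b : ℕ) : ZMod N) * Complex.exp (2 * Real.pi * Complex.I * (b : ℂ) / (N : ℂ))

/-- The Gauss sum `τ(χ̄)` of the complex conjugate character. -/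
noncomputable def gaussSumConj {N : ℕ} (χ : DirichletCharacter ℂ N) : ℂ :=
  ∑ b ∈ Finset.Icc 1 N,
    (starRingEnd ℂ) (χ ((b : ℕ) : ZMod N)) *
      Complex.exp (2 * Real.pi * Complex.I * (b : ℂ) / (N : ℂ))

/-- `Q̃₊(y, X, δ)`: sum over primitive even characters of conductor
`N ∈ [X, X + X^δ]`, `N ≢ 2 (mod 4)`. -/
noncomputable def QplusTilde (y X δ : ℝ) : ℂ :=
  (Complex.ofReal (1 / X ^ δ)) *
    ∑ N ∈ (Finset.range (Nat.floor (X + X ^ δ) + 1)).filter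
        (fun N : ℕ => 0 < N ∧ X ≤ (N : ℝ) ∧ (N : ℝ) ≤ X + X ^ δ ∧ N % 4 ≠ 2),
      ∑ᶠ χ ∈ {χ : DirichletCharacter ℂ N | χ.IsPrimitive ∧ χ (-1) = 1},
        χ ((leastPrime (y * X) : ℕ) : ZMod N) / gaussSum' χ

/-- `Ẽ₊(y, X, δ)`: sum over imprimitive non-principal even characters mod
`N ∈ [X, X + X^δ]`, `N ≢ 2 (mod 4)`. -/
noncomputable def EplusTilde (y X δ : ℝ) : ℂ :=
  (Complex.ofReal (1 / X ^ δ)) *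
    ∑ N ∈ (Finset.range (Nat.floor (X + X ^ δ) + 1)).filter
        (fun N : ℕ => 0 < N ∧ X ≤ (N : ℝ) ∧ (N : ℝ) ≤ X + X ^ δ ∧ N % 4 ≠ 2),
      (Complex.ofReal (1 / (N : ℝ))) *
        ∑ᶠ χ ∈ {χ : DirichletCharacter ℂ N | ¬χ.IsPrimitive ∧ χ ≠ 1 ∧ χ (-1) = 1},
          gaussSumConj χ * χ ((leastPrime (y * X) : ℕ) : ZMod N)

/-- The Fejér kernel `∫₀ᵀ (1 - ξ/T) cos (ξ t) dξ`. -/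
noncomputable def fejer (T t : ℝ) : ℝ := ∫ ξ in (0 : ℝ)..T, (1 - ξ / T) * Real.cos (ξ * t)

lemma integral_one_sub_div {T : ℝ} (hT : 0 < T) : ∫ ξ in (0 : ℝ)..T, (1 - ξ / T) = T / 2 := by
  rw [intervalIntegral.integral_sub (by simp) (by
    apply Continuous.intervalIntegrable; fun_prop)]
  simp only [intervalIntegral.integral_const, intervalIntegral.integral_div, integral_id]
  field_simp
  simp
  ring

lemma fejer_of_ne_zero {T t : ℝ} (hT : 0 < T) (ht : t ≠ 0) :
    fejer T t = (1 - Real.cos (T * t)) / (T * t ^ 2) := by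
  have key : ∀ ξ ∈ Set.uIcc 0 T, HasDerivAt
      (fun ξ : ℝ => (1 - ξ / T) * (Real.sin (ξ * t) / t) - Real.cos (ξ * t) / (T * t ^ 2))
      ((1 - ξ / T) * Real.cos (ξ * t)) ξ := by
    intro ξ _
    have h0 : HasDerivAt (fun ξ : ℝ => ξ * t) t ξ := by
      simpa using (hasDerivAt_id ξ).mul_const t
    have h1 := h0.sin.div_const t
    have h2 := h0.cos.div_const (T * t ^ 2)
    have h3 : HasDerivAt (fun ξ : ℝ => 1 - ξ / T) (-(1 / T)) ξ :=
      ((hasDerivAt_id ξ).div_const T).const_sub 1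
    refine ((h3.mul h1).sub h2).congr_deriv ?_
    field_simp
    ring
  rw [fejer, intervalIntegral.integral_eq_sub_of_hasDerivAt key
    (by apply Continuous.intervalIntegrable; fun_prop)]
  simp
  field_simp
  ring

lemma fejer_nonneg {T : ℝ} (hT : 0 < T) (t : ℝ) : 0 ≤ fejer T t := by
  rcases eq_or_ne t 0 with rfl | ht
  · simp only [fejer, mul_zero, Real.cos_zero, mul_one, integral_one_sub_div hT]
    positivity
  · rw [fejer_of_ne_zero hT ht]
    have := Real.cos_le_one (T * t)
    exact div_nonneg (by linarith) (by positivity)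

lemma fejer_le {T : ℝ} (hT : 0 < T) (t : ℝ) : fejer T t ≤ T := by
  have h : fejer T t ≤ ∫ ξ in (0 : ℝ)..T, (1 - ξ / T) := by
    refine intervalIntegral.integral_mono_on hT.le
      (by apply Continuous.intervalIntegrable; fun_prop)
      (by apply Continuous.intervalIntegrable; fun_prop) fun ξ hξ => ?_
    have : 0 ≤ 1 - ξ / T := by
      rw [sub_nonneg, div_le_one hT]; exact hξ.2
    exact mul_le_of_le_one_right this (Real.cos_le_one _)
  rw [integral_one_sub_div hT] at h
  linarith

lemma fejer_le_div_sq {T t : ℝ} (hT : 0 < T) (ht : t ≠ 0) : fejer T t ≤ 2 / (T * t ^ 2) := by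
  rw [fejer_of_ne_zero hT ht]
  have := Real.neg_one_le_cos (T * t)
  gcongr
  linarith

lemma le_fejer {T t : ℝ} (hT : 0 < T) (ht : |t| ≤ 1 / T) : T / 4 ≤ fejer T t := by
  have h : ∫ ξ in (0 : ℝ)..T, (1 - ξ / T) * (1 / 2) ≤ fejer T t := by
    refine intervalIntegral.integral_mono_on hT.le
      (by apply Continuous.intervalIntegrable; fun_prop)
      (by apply Continuous.intervalIntegrable; fun_prop) fun ξ hξ => ?_
    have h0 : 0 ≤ 1 - ξ / T := by
      rw [sub_nonneg, div_le_one hT]; exact hξ.2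
    refine mul_le_mul_of_nonneg_left ?_ h0
    have h1 : |ξ * t| ≤ 1 := by
      rw [abs_mul, abs_of_nonneg hξ.1]
      calc ξ * |t| ≤ T * (1 / T) := mul_le_mul hξ.2 ht (abs_nonneg _) hT.le
        _ = 1 := by field_simp
    have h2 := Real.one_sub_sq_div_two_le_cos (x := ξ * t)
    have h3 : (ξ * t) ^ 2 ≤ 1 := (sq_le_one_iff_abs_le_one _).2 h1
    linarith
  rw [intervalIntegral.integral_mul_const, integral_one_sub_div hT] at h
  linarith

lemma hasSum_fejer {a : ℕ → ℝ} {σ : ℝ} (hs : LSeriesSummable (fun n => (a n : ℂ)) σ)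
    {T : ℝ} (hT : 0 < T) (u : ℝ) :
    HasSum (fun n : ℕ => (LSeries.term (fun n => (a n : ℂ)) σ n).re * fejer T (Real.log n - u))
      (∫ ξ in (0 : ℝ)..T, (1 - ξ / T) *
        (Complex.exp (Complex.I * (u * ξ : ℝ)) *
          LSeries (fun n => (a n : ℂ)) (σ + Complex.I * ξ)).re) := by
  set f : ℕ → ℂ := fun n => (a n : ℂ) with hf
  have hterm : ∀ (n : ℕ) (ξ : ℝ), LSeries.term f (σ + Complex.I * ξ) n =
      ((LSeries.term f σ n).re : ℂ) * Complex.exp (-(Complex.I * (ξ * Real.log n : ℝ))) := by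
    intro n ξ
    rcases eq_or_ne n 0 with rfl | hn
    · simp
    have hn' : (n : ℂ) ≠ 0 := by exact_mod_cast hn
    have h1 : (LSeries.term f σ n) = ((a n / (n : ℝ) ^ σ : ℝ) : ℂ) := by
      rw [LSeries.term_of_ne_zero hn]
      push_cast
      rw [Complex.ofReal_cpow (by positivity)]
      simp [hf]
    rw [h1, Complex.ofReal_re, ← h1, LSeries.term_of_ne_zero hn, LSeries.term_of_ne_zero hn,
      Complex.cpow_add _ _ hn', Complex.exp_neg]
    have h2 : (n : ℂ) ^ (Complex.I * (ξ : ℂ)) = Complex.exp (Complex.I * (ξ * Real.log n : ℝ)) := by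
      rw [Complex.cpow_def_of_ne_zero hn']
      push_cast
      congr 1
      ring
    rw [h2]
    field_simp
  have hF : ∀ (n : ℕ) (ξ : ℝ), (1 - ξ / T) *
      (Complex.exp (Complex.I * (u * ξ : ℝ)) * LSeries.term f (σ + Complex.I * ξ) n).re =
      (LSeries.term f σ n).re * ((1 - ξ / T) * Real.cos (ξ * (Real.log n - u))) := by
    intro n ξ
    rw [hterm, mul_left_comm, ← Complex.exp_add, Complex.re_ofReal_mul]
    have : Complex.I * (u * ξ : ℝ) + -(Complex.I * (ξ * Real.log n : ℝ)) =
        ((-(ξ * (Real.log n - u)) : ℝ) : ℂ) * Complex.I := by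
      push_cast; ring
    rw [this, Complex.exp_ofReal_mul_I_re, Real.cos_neg]
    ring
  have hsum := hs.norm
  have := intervalIntegral.hasSum_integral_of_dominated_convergence (a := 0) (b := T)
    (μ := MeasureTheory.volume)
    (F := fun (n : ℕ) (ξ : ℝ) => (1 - ξ / T) *
      (Complex.exp (Complex.I * (u * ξ : ℝ)) * LSeries.term f (σ + Complex.I * ξ) n).re)
    (f := fun ξ => (1 - ξ / T) *
        (Complex.exp (Complex.I * (u * ξ : ℝ)) * LSeries f (σ + Complex.I * ξ)).re)
    (fun n _ => ‖LSeries.term f σ n‖) ?_ ?_ ?_ ?_ ?_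
  · have h3 : ∀ n : ℕ, (∫ ξ in (0 : ℝ)..T, (1 - ξ / T) * (Complex.exp (Complex.I * (u * ξ : ℝ)) *
        LSeries.term f (σ + Complex.I * ξ) n).re) =
        (LSeries.term f σ n).re * fejer T (Real.log n - u) := by
      intro n
      rw [fejer, ← intervalIntegral.integral_const_mul]
      exact intervalIntegral.integral_congr fun ξ _ => hF n ξ
    simpa only [h3] using this
  · intro n
    simp_rw [hF]
    apply Continuous.aestronglyMeasurable
    fun_prop
  · intro n
    refine Filter.Eventually.of_forall fun ξ hξ => ?_
    rw [Set.uIoc_of_le hT.le] at hξ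
    rw [hF, norm_mul, norm_mul]
    have h0 : ‖1 - ξ / T‖ ≤ 1 := by
      have h1 : 0 ≤ ξ / T := div_nonneg hξ.1.le hT.le
      have h2 : ξ / T ≤ 1 := (div_le_one hT).2 hξ.2
      rw [Real.norm_eq_abs, abs_le]
      constructor <;> linarith
    have h1 : ‖Real.cos (ξ * (Real.log n - u))‖ ≤ 1 := Real.abs_cos_le_one _
    have h2 : ‖(LSeries.term f σ n).re‖ ≤ ‖LSeries.term f σ n‖ := Complex.abs_re_le_norm _
    calc _ ≤ ‖LSeries.term f σ n‖ * (1 * 1) := by gcongr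
      _ = _ := by ring
  · exact Filter.Eventually.of_forall fun ξ _ => hsum
  · simp
  · refine Filter.Eventually.of_forall fun ξ _ => ?_
    have h1 : LSeriesSummable f (σ + Complex.I * ξ) := by
      refine hs.of_re_le_re ?_
      simp
    have h2 := (h1.hasSum.mul_left (Complex.exp (Complex.I * (u * ξ : ℝ))))
    exact (Complex.hasSum_re h2).mul_left (1 - ξ / T)

lemma summable_int_one_div_one_add_sq : Summable fun k : ℤ => 1 / (1 + (k : ℝ) ^ 2) := by
  refine Summable.of_norm_bounded_eventually (Real.summable_one_div_int_pow.2 one_lt_two) ?_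
  rw [Filter.eventually_cofinite]
  refine (Set.finite_singleton (0 : ℤ)).subset fun k hk => ?_
  by_contra h0
  refine hk ?_
  have h0' : (k : ℝ) ≠ 0 := by exact_mod_cast h0
  rw [Real.norm_of_nonneg (by positivity)]
  gcongr
  linarith

/-- A smoothed form of Chebyshev's upper bound. -/
lemma exists_sum_vonMangoldt_div_le : ∃ C : ℝ, 0 < C ∧ ∀ (u : ℝ) (F : Finset ℕ),
    ∑ n ∈ F, ArithmeticFunction.vonMangoldt n / n * (1 / (1 + (Real.log n - u) ^ 2)) ≤ C := by
  set A : ℝ := (Real.log 4 + 4) * Real.exp 1 * 4 with hA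
  have hA0 : 0 < A := by
    have := Real.log_pos (x := 4) (by norm_num)
    positivity
  have hS := summable_int_one_div_one_add_sq
  refine ⟨A * (∑' k : ℤ, 1 / (1 + (k : ℝ) ^ 2)),
    mul_pos hA0 (hS.tsum_pos (fun k => by positivity) 0 (by positivity)), fun u F => ?_⟩
  rw [← Finset.sum_fiberwise_of_maps_to (t := F.image fun n : ℕ => ⌊Real.log n - u⌋)
    (g := fun n : ℕ => ⌊Real.log n - u⌋) (fun n hn => Finset.mem_image_of_mem _ hn), ← tsum_mul_left]
  refine le_trans (Finset.sum_le_sum fun k _ => ?_)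
    ((hS.mul_left A).sum_le_tsum _ fun k _ => by positivity)
  have hx : 0 < Real.exp (u + k) := Real.exp_pos _
  have hterm : ∀ n ∈ F.filter (fun n : ℕ => ⌊Real.log n - u⌋ = k),
      ArithmeticFunction.vonMangoldt n / n * (1 / (1 + (Real.log n - u) ^ 2)) ≤
      ArithmeticFunction.vonMangoldt n * ((Real.exp (u + k))⁻¹ * (4 * (1 / (1 + (k : ℝ) ^ 2)))) := by
    intro n hn
    rcases Nat.eq_zero_or_pos n with rfl | hpos
    · simp
    have hfl := (Finset.mem_filter.1 hn).2
    rw [Int.floor_eq_iff] at hfl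
    have hpos' : (0 : ℝ) < n := by exact_mod_cast hpos
    have h1 : Real.exp (u + k) ≤ n := by
      rw [← Real.le_log_iff_exp_le hpos']; linarith
    have h2 : 1 / (1 + (Real.log n - u) ^ 2) ≤ 4 * (1 / (1 + (k : ℝ) ^ 2)) := by
      rw [mul_one_div, div_le_div_iff₀ (by positivity) (by positivity)]
      nlinarith [hfl.1, hfl.2, sq_nonneg (Real.log n - u), sq_nonneg (Real.log n - u + 1),
        sq_nonneg (Real.log n - u - 1), sq_nonneg (Real.log n - u + (k - (Real.log n - u)) * 1),
        sq_nonneg (2 * (Real.log n - u) - k)]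
    rw [div_eq_mul_inv, mul_assoc]
    have := ArithmeticFunction.vonMangoldt_nonneg (n := n)
    gcongr
  refine (Finset.sum_le_sum hterm).trans ?_
  rw [← Finset.sum_mul]
  have hpsi : ∑ n ∈ F.filter (fun n : ℕ => ⌊Real.log n - u⌋ = k),
      ArithmeticFunction.vonMangoldt n ≤ (Real.log 4 + 4) * Real.exp (u + k + 1) := by
    refine le_trans ?_ (Chebyshev.psi_le_const_mul_self (Real.exp_pos _).le)
    rw [Chebyshev.psi]
    rw [← Finset.sum_filter_add_sum_filter_not _ (fun n : ℕ => n = 0)]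
    have hz : ∑ n ∈ (F.filter (fun n : ℕ => ⌊Real.log n - u⌋ = k)).filter (fun n : ℕ => n = 0),
        ArithmeticFunction.vonMangoldt n = 0 := by
      refine Finset.sum_eq_zero fun n hn => ?_
      rw [(Finset.mem_filter.1 hn).2]; simp
    rw [hz, zero_add]
    refine Finset.sum_le_sum_of_subset_of_nonneg (fun n hn => ?_)
      fun n _ _ => ArithmeticFunction.vonMangoldt_nonneg
    simp only [Finset.mem_filter, Int.floor_eq_iff] at hn
    obtain ⟨⟨-, h1, h2⟩, h0⟩ := hn
    have hpos : 0 < n := Nat.pos_of_ne_zero h0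
    have hpos' : (0 : ℝ) < n := by exact_mod_cast hpos
    rw [Finset.mem_Ioc]
    refine ⟨hpos, Nat.le_floor ?_⟩
    rw [← Real.log_le_iff_le_exp hpos']
    linarith
  calc _ ≤ (Real.log 4 + 4) * Real.exp (u + k + 1) *
        ((Real.exp (u + k))⁻¹ * (4 * (1 / (1 + (k : ℝ) ^ 2)))) := by gcongr
    _ = _ := by
      rw [Real.exp_add (u + k) 1, hA]
      field_simp

/-- The continuous extension to `1 ≤ re s` of `-ζ'/ζ - ζ`. -/
noncomputable def zetaRemainder (s : ℂ) : ℂ :=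
  -(deriv riemannZeta₁ s / riemannZeta₁ s) - riemannZeta₀ s

lemma riemannZeta₁_ne_zero {s : ℂ} (hs : 1 ≤ s.re) : riemannZeta₁ s ≠ 0 := by
  rcases eq_or_ne s 1 with rfl | h1
  · simp [riemannZeta₁_one]
  · intro h
    have := riemannZeta_eq_inv_sub_mul h1
    rw [h, mul_zero] at this
    exact riemannZeta_ne_zero_of_one_le_re hs this

lemma continuousAt_zetaRemainder {s : ℂ} (hs : 1 ≤ s.re) : ContinuousAt zetaRemainder s := by
  have h1 : ContinuousAt (deriv riemannZeta₁) s :=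
    (differentiable_riemannZeta₁.contDiff (n := 1)).continuous_deriv le_rfl |>.continuousAt
  exact ((h1.div differentiable_riemannZeta₁.continuous.continuousAt
    (riemannZeta₁_ne_zero hs)).neg).sub differentiable_riemannZeta₀.continuous.continuousAt

lemma LSeries_vonMangoldt_sub_LSeries_one {s : ℂ} (hs : 1 < s.re) :
    LSeries (fun n => ((ArithmeticFunction.vonMangoldt n : ℝ) : ℂ)) s -
      LSeries (fun _ => ((1 : ℝ) : ℂ)) s = zetaRemainder s := by
  have h1 : s ≠ 1 := by rintro rfl; simp at hs
  have h2 : s - 1 ≠ 0 := sub_ne_zero.2 h1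
  have h3 := riemannZeta₁_ne_zero hs.le
  have hone : LSeries (fun _ => ((1 : ℝ) : ℂ)) s = riemannZeta s := by
    rw [← LSeries_one_eq_riemannZeta hs]
    congr 1
  rw [ArithmeticFunction.LSeries_vonMangoldt_eq_deriv_riemannZeta_div hs, hone,
    deriv_riemannZeta_eq_neg_inv_sub_sq_mul_add h1, riemannZeta_eq_inv_sub_mul h1, zetaRemainder]
  have h4 : (s - 1)⁻¹ * riemannZeta₁ s = (s - 1)⁻¹ + riemannZeta₀ s := by
    rw [← riemannZeta_eq_inv_sub_mul h1, riemannZeta_eq_inv_sub_add h1]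
  have h5 : -(-(s - 1)⁻¹ ^ 2 * riemannZeta₁ s + (s - 1)⁻¹ * deriv riemannZeta₁ s) /
      ((s - 1)⁻¹ * riemannZeta₁ s) = (s - 1)⁻¹ - deriv riemannZeta₁ s / riemannZeta₁ s := by
    field_simp
    ring
  rw [h5, h4]
  ring

/-- The Fourier integral of `zetaRemainder` on the line `re s = max σ 1`. -/
noncomputable def remainderIntegral (T u σ : ℝ) : ℝ :=
  ∫ ξ in (0 : ℝ)..T, (1 - ξ / T) * (Complex.exp (Complex.I * (u * ξ : ℝ)) *
    zetaRemainder ((max σ 1 : ℝ) + Complex.I * ξ)).re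

lemma continuous_zetaRemainder_line :
    Continuous fun p : ℝ × ℝ => zetaRemainder ((max p.1 1 : ℝ) + Complex.I * p.2) := by
  rw [continuous_iff_continuousAt]
  intro p
  refine ContinuousAt.comp (f := fun p : ℝ × ℝ => ((max p.1 1 : ℝ) + Complex.I * p.2 : ℂ))
    (continuousAt_zetaRemainder ?_) ?_
  · simp
  · apply Continuous.continuousAt
    fun_prop

lemma continuous_remainderIntegral (T u : ℝ) : Continuous (remainderIntegral T u) := by
  refine intervalIntegral.continuous_parametric_intervalIntegral_of_continuous' (μ := MeasureTheory.volume) (f := fun σ ξ =>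
    (1 - ξ / T) * (Complex.exp (Complex.I * (u * ξ : ℝ)) *
    zetaRemainder ((max σ 1 : ℝ) + Complex.I * ξ)).re) ?_ 0 T
  have h := continuous_zetaRemainder_line
  have h1 : Continuous fun p : ℝ × ℝ => 1 - p.2 / T := by fun_prop
  have h2 : Continuous fun p : ℝ × ℝ => Complex.exp (Complex.I * (u * p.2 : ℝ)) := by fun_prop
  exact h1.mul (Complex.continuous_re.comp (h2.mul h))

lemma tendsto_remainderIntegral (T : ℝ) (hT : 0 < T) :
    Tendsto (fun u => remainderIntegral T u 1) atTop (𝓝 0) := by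
  set g : ℝ → ℂ := Set.indicator (Set.Ioc 0 T) fun ξ =>
    ((1 - ξ / T : ℝ) : ℂ) * zetaRemainder ((1 : ℝ) + Complex.I * ξ) with hg
  have hRL := Real.tendsto_integral_exp_smul_cocompact g
  have hmap : Tendsto (fun u : ℝ => -u / (2 * Real.pi)) atTop (cocompact ℝ) := by
    refine Tendsto.mono_right ?_ atBot_le_cocompact
    exact (tendsto_neg_atTop_atBot).atBot_div_const (by positivity)
  have h := (Complex.continuous_re.tendsto _).comp (hRL.comp hmap)
  simp only [Complex.zero_re] at h
  refine h.congr fun u => ?_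
  simp only [Function.comp_apply]
  have hc : Continuous fun ξ : ℝ => zetaRemainder ((1 : ℝ) + Complex.I * ξ) := by
    simpa [Function.comp_def] using
      continuous_zetaRemainder_line.comp (Continuous.prodMk_right (1 : ℝ))
  have h1 : ∀ v : ℝ, Real.fourierChar (-(v * (-u / (2 * Real.pi)))) • g v =
      Set.indicator (Set.Ioc 0 T) (fun ξ => ((1 - ξ / T : ℝ) : ℂ) *
        (Complex.exp (Complex.I * (u * ξ : ℝ)) * zetaRemainder ((1 : ℝ) + Complex.I * ξ))) v := by
    intro v
    simp only [hg, Set.indicator_apply]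
    split_ifs with hv
    · rw [Circle.smul_def, Real.fourierChar_apply, smul_eq_mul, mul_left_comm]
      congr 3
      have := Real.pi_ne_zero
      push_cast
      field_simp
    · simp
  simp_rw [h1]
  rw [MeasureTheory.integral_indicator measurableSet_Ioc,
    ← intervalIntegral.integral_of_le hT.le, remainderIntegral, ← Complex.reCLM_apply,
    ← ContinuousLinearMap.intervalIntegral_comp_comm]
  · refine intervalIntegral.integral_congr fun ξ _ => ?_
    simp [Complex.re_ofReal_mul, -Complex.ofReal_sub, -Complex.ofReal_div, -Complex.mul_re]
  · apply Continuous.intervalIntegrable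
    fun_prop

lemma summable_and_tsum_fejer {T : ℝ} (hT : 0 < T) (u : ℝ) {σ : ℝ} (hσ : 1 < σ) :
    (Summable fun n : ℕ => (LSeries.term (fun n => ((ArithmeticFunction.vonMangoldt n : ℝ) : ℂ)) σ n).re
      * fejer T (Real.log n - u)) ∧
    (Summable fun n : ℕ => (LSeries.term (fun _ => ((1 : ℝ) : ℂ)) σ n).re
      * fejer T (Real.log n - u)) ∧
    ∑' n : ℕ, (LSeries.term (fun _ => ((1 : ℝ) : ℂ)) σ n).re * fejer T (Real.log n - u) =
    ∑' n : ℕ, (LSeries.term (fun n => ((ArithmeticFunction.vonMangoldt n : ℝ) : ℂ)) σ n).re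
      * fejer T (Real.log n - u) - remainderIntegral T u σ := by
  have hσ' : 1 < (σ : ℂ).re := by simpa
  have s1 : LSeriesSummable (fun n => ((ArithmeticFunction.vonMangoldt n : ℝ) : ℂ)) σ :=
    ArithmeticFunction.LSeriesSummable_vonMangoldt hσ'
  have s2 : LSeriesSummable (fun _ => ((1 : ℝ) : ℂ)) σ := by
    simpa [Pi.one_def] using LSeriesSummable_one_iff.2 hσ'
  have h1 := hasSum_fejer s1 hT u
  have h2 := hasSum_fejer s2 hT u
  refine ⟨h1.summable, h2.summable, ?_⟩
  have s1' := fun ξ : ℝ => s1.of_re_le_re (s' := σ + Complex.I * ξ) (by simp)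
  have s2' := fun ξ : ℝ => s2.of_re_le_re (s' := σ + Complex.I * ξ) (by simp)
  have hfun : (fun n => ((ArithmeticFunction.vonMangoldt n - 1 : ℝ) : ℂ)) =
      (fun n => ((ArithmeticFunction.vonMangoldt n : ℝ) : ℂ)) - fun _ => ((1 : ℝ) : ℂ) := by
    ext n; simp
  have h3 := hasSum_fejer (a := fun n => ArithmeticFunction.vonMangoldt n - 1) (σ := σ)
    (by rw [hfun]; exact s1.sub s2) hT u
  rw [hfun] at h3
  have h4 := h1.sub h2
  simp_rw [← sub_mul, ← Complex.sub_re, ← LSeries.term_sub_apply] at h4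
  have h5 : remainderIntegral T u σ = ∫ ξ in (0 : ℝ)..T, (1 - ξ / T) *
        (Complex.exp (Complex.I * (u * ξ : ℝ)) *
          LSeries ((fun n => ((ArithmeticFunction.vonMangoldt n : ℝ) : ℂ)) - fun _ => ((1 : ℝ) : ℂ))
            (σ + Complex.I * ξ)).re := by
    rw [remainderIntegral, max_eq_left hσ.le]
    refine intervalIntegral.integral_congr fun ξ _ => ?_
    have hre : 1 < ((σ : ℂ) + Complex.I * ξ).re := by simpa
    have := LSeries_vonMangoldt_sub_LSeries_one hre
    rw [← LSeries_sub (s1' ξ) (s2' ξ)] at this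
    simp only [this]
  rw [h5, ← h4.unique h3, h1.tsum_eq, h2.tsum_eq]
  ring

lemma re_term_ofReal (a : ℕ → ℝ) (σ : ℝ) {n : ℕ} (hn : n ≠ 0) :
    (LSeries.term (fun n => (a n : ℂ)) σ n).re = a n / (n : ℝ) ^ σ := by
  rw [LSeries.term_of_ne_zero hn]
  have h : ((a n : ℂ) / (n : ℂ) ^ (σ : ℂ)) = ((a n / (n : ℝ) ^ σ : ℝ) : ℂ) := by
    push_cast
    rw [Complex.ofReal_cpow (by positivity)]
    simp
  rw [h, Complex.ofReal_re]

lemma re_term_le_div {a : ℕ → ℝ} (ha : ∀ n, 0 ≤ a n) {σ : ℝ} (hσ : 1 ≤ σ) (n : ℕ) :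
    (LSeries.term (fun n => (a n : ℂ)) σ n).re ≤ a n / n := by
  rcases eq_or_ne n 0 with rfl | hn
  · simp
  · rw [re_term_ofReal a σ hn]
    have h1 : (1 : ℝ) ≤ n := by exact_mod_cast Nat.one_le_iff_ne_zero.2 hn
    refine div_le_div_of_nonneg_left (ha n) (by linarith) ?_
    simpa using Real.rpow_le_rpow_of_exponent_le h1 hσ

lemma re_term_nonneg {a : ℕ → ℝ} (ha : ∀ n, 0 ≤ a n) (σ : ℝ) (n : ℕ) :
    0 ≤ (LSeries.term (fun n => (a n : ℂ)) σ n).re := by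
  rcases eq_or_ne n 0 with rfl | hn
  · simp
  · rw [re_term_ofReal a σ hn]
    exact div_nonneg (ha n) (by positivity)

lemma fejer_le_of_lt_abs {T t η : ℝ} (hT : 0 < T) (hη : 0 < η) (ht : η < |t|) :
    fejer T t ≤ 2 / T * (1 + 1 / η ^ 2) * (1 / (1 + t ^ 2)) := by
  have ht0 : t ≠ 0 := abs_pos.1 (hη.trans ht)
  refine (fejer_le_div_sq hT ht0).trans ?_
  have h1 : η ^ 2 ≤ t ^ 2 := by
    rw [← sq_abs t]; gcongr
  have h3 : 0 < t ^ 2 := by positivity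
  have h4 : 0 < η ^ 2 := by positivity
  have h2 : 1 / t ^ 2 ≤ (1 + 1 / η ^ 2) * (1 / (1 + t ^ 2)) := by
    rw [mul_one_div, div_le_div_iff₀ h3 (by positivity)]
    have : 1 ≤ 1 / η ^ 2 * t ^ 2 := by
      rw [one_div_mul_eq_div, le_div_iff₀ h4]; linarith
    linarith
  calc 2 / (T * t ^ 2) = 2 / T * (1 / t ^ 2) := by field_simp
    _ ≤ 2 / T * ((1 + 1 / η ^ 2) * (1 / (1 + t ^ 2))) := by gcongr
    _ = _ := by ring

lemma sum_vonMangoldt_near_le {η x : ℝ} (hη : 0 < η) (hx : 0 < x) (F : Finset ℕ) :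
    ∑ n ∈ F.filter (fun n : ℕ => |Real.log n - Real.log x| ≤ η), ArithmeticFunction.vonMangoldt n / n ≤
      Real.exp η / x * (Chebyshev.psi (x * Real.exp η) - Chebyshev.psi (x * Real.exp (-(2 * η)))) := by
  set a := x * Real.exp (-(2 * η))
  set b := x * Real.exp η
  have hab : a ≤ b := by
    refine mul_le_mul_of_nonneg_left (Real.exp_le_exp.2 (by linarith)) hx.le
  have hfl : ⌊a⌋₊ ≤ ⌊b⌋₊ := Nat.floor_le_floor hab
  have hpsi : Chebyshev.psi b - Chebyshev.psi a =
      ∑ n ∈ Finset.Ioc ⌊a⌋₊ ⌊b⌋₊, ArithmeticFunction.vonMangoldt n := by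
    rw [Chebyshev.psi, Chebyshev.psi, sub_eq_iff_eq_add, add_comm,
      Finset.sum_Ioc_consecutive _ (Nat.zero_le _) hfl]
  rw [hpsi, Finset.mul_sum]
  have hE : 0 < Real.exp η / x := div_pos (Real.exp_pos _) hx
  rw [← Finset.sum_filter_add_sum_filter_not _ (fun n : ℕ => n = 0)]
  have hz : ∑ n ∈ (F.filter (fun n : ℕ => |Real.log n - Real.log x| ≤ η)).filter (fun n : ℕ => n = 0),
      ArithmeticFunction.vonMangoldt n / n = 0 := by
    refine Finset.sum_eq_zero fun n hn => ?_
    rw [(Finset.mem_filter.1 hn).2]; simp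
  rw [hz, zero_add]
  have hmem : ∀ n ∈ (F.filter (fun n : ℕ => |Real.log n - Real.log x| ≤ η)).filter
      (fun n : ℕ => ¬ n = 0), x * Real.exp (-η) ≤ n ∧ (n : ℝ) ≤ b := by
    intro n hn
    simp only [Finset.mem_filter, abs_le] at hn
    obtain ⟨⟨-, h1, h2⟩, h0⟩ := hn
    have hpos : (0 : ℝ) < n := by exact_mod_cast Nat.pos_of_ne_zero h0
    constructor
    · rw [← Real.exp_log hx, ← Real.exp_add, ← Real.le_log_iff_exp_le hpos]
      linarith
    · simp only [b]
      rw [← Real.exp_log hx, ← Real.exp_add, ← Real.log_le_iff_le_exp hpos]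
      linarith
  calc _ ≤ ∑ n ∈ (F.filter (fun n : ℕ => |Real.log n - Real.log x| ≤ η)).filter
        (fun n : ℕ => ¬ n = 0), Real.exp η / x * ArithmeticFunction.vonMangoldt n := by
        refine Finset.sum_le_sum fun n hn => ?_
        have h1 := (hmem n hn).1
        rw [div_eq_mul_inv, mul_comm]
        refine mul_le_mul_of_nonneg_right ?_ ArithmeticFunction.vonMangoldt_nonneg
        have : Real.exp η / x = (x * Real.exp (-η))⁻¹ := by
          rw [Real.exp_neg]; field_simp
        rw [this]
        exact inv_anti₀ (by positivity) h1
    _ ≤ _ := by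
        refine Finset.sum_le_sum_of_subset_of_nonneg (fun n hn => ?_) fun n _ _ =>
          mul_nonneg hE.le ArithmeticFunction.vonMangoldt_nonneg
        obtain ⟨h1, h2⟩ := hmem n hn
        rw [Finset.mem_Ioc]
        refine ⟨?_, Nat.le_floor h2⟩
        rw [Nat.floor_lt (by positivity)]
        refine lt_of_lt_of_le ?_ h1
        exact mul_lt_mul_of_pos_left (Real.exp_lt_exp.2 (by linarith)) hx

lemma tsum_vonMangoldt_fejer_le {C : ℝ} (hC : ∀ (u : ℝ) (F : Finset ℕ),
    ∑ n ∈ F, ArithmeticFunction.vonMangoldt n / n * (1 / (1 + (Real.log n - u) ^ 2)) ≤ C)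
    {T η x σ : ℝ} (hT : 0 < T) (hη : 0 < η) (hx : 0 < x) (hσ : 1 < σ) :
    ∑' n : ℕ, (LSeries.term (fun n => ((ArithmeticFunction.vonMangoldt n : ℝ) : ℂ)) σ n).re
      * fejer T (Real.log n - Real.log x) ≤
    Real.exp η / x * (Chebyshev.psi (x * Real.exp η) - Chebyshev.psi (x * Real.exp (-(2 * η)))) * T +
      2 / T * (1 + 1 / η ^ 2) * C := by
  refine (summable_and_tsum_fejer hT (Real.log x) hσ).1.tsum_le_of_sum_le fun F => ?_
  rw [← Finset.sum_filter_add_sum_filter_not F (fun n : ℕ => |Real.log n - Real.log x| ≤ η)]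
  have hΛ : ∀ n, 0 ≤ ArithmeticFunction.vonMangoldt n :=
    fun n => ArithmeticFunction.vonMangoldt_nonneg
  refine add_le_add ?_ ?_
  · refine le_trans ?_ (mul_le_mul_of_nonneg_right (sum_vonMangoldt_near_le hη hx F) hT.le)
    rw [Finset.sum_mul]
    refine Finset.sum_le_sum fun n _ => ?_
    exact mul_le_mul (re_term_le_div hΛ hσ.le n) (fejer_le hT _) (fejer_nonneg hT _)
      (div_nonneg (hΛ n) (by positivity))
  · refine le_trans ?_ (mul_le_mul_of_nonneg_left
      (hC (Real.log x) (F.filter fun n : ℕ => ¬|Real.log n - Real.log x| ≤ η)) (by positivity))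
    rw [Finset.mul_sum]
    refine Finset.sum_le_sum fun n hn => ?_
    have h1 := fejer_le_of_lt_abs hT hη (not_le.1 (Finset.mem_filter.1 hn).2)
    calc _ ≤ ArithmeticFunction.vonMangoldt n / n *
        (2 / T * (1 + 1 / η ^ 2) * (1 / (1 + (Real.log n - Real.log x) ^ 2))) :=
          mul_le_mul (re_term_le_div hΛ hσ.le n) h1 (fejer_nonneg hT _)
            (div_nonneg (hΛ n) (by positivity))
      _ = _ := by ring

lemma sum_window_fejer_le {C : ℝ} (hC : ∀ (u : ℝ) (F : Finset ℕ),
    ∑ n ∈ F, ArithmeticFunction.vonMangoldt n / n * (1 / (1 + (Real.log n - u) ^ 2)) ≤ C)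
    {T η x : ℝ} (hT : 0 < T) (hη : 0 < η) (hx : 0 < x) (W : Finset ℕ) (hW : ∀ n ∈ W, n ≠ 0) :
    ∑ n ∈ W, (1 / (n : ℝ)) * fejer T (Real.log n - Real.log x) ≤
    Real.exp η / x * (Chebyshev.psi (x * Real.exp η) - Chebyshev.psi (x * Real.exp (-(2 * η)))) * T +
      2 / T * (1 + 1 / η ^ 2) * C - remainderIntegral T (Real.log x) 1 := by
  set B := Real.exp η / x * (Chebyshev.psi (x * Real.exp η) - Chebyshev.psi (x * Real.exp (-(2 * η)))) * T +
      2 / T * (1 + 1 / η ^ 2) * C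
  have h1 : Tendsto (fun σ : ℝ => ∑ n ∈ W, (1 / (n : ℝ) ^ σ) * fejer T (Real.log n - Real.log x))
      (𝓝[>] 1) (𝓝 (∑ n ∈ W, (1 / (n : ℝ) ^ (1 : ℝ)) * fejer T (Real.log n - Real.log x))) := by
    refine tendsto_nhdsWithin_of_tendsto_nhds (tendsto_finsetSum _ fun n hn => ?_)
    have hn0 : (0 : ℝ) < n := by exact_mod_cast Nat.pos_of_ne_zero (hW n hn)
    refine Tendsto.mul_const _ (Tendsto.div tendsto_const_nhds ?_ (by positivity))
    exact (Real.continuousAt_const_rpow hn0.ne').tendsto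
  have h2 : Tendsto (fun σ : ℝ => B - remainderIntegral T (Real.log x) σ) (𝓝[>] 1)
      (𝓝 (B - remainderIntegral T (Real.log x) 1)) :=
    tendsto_nhdsWithin_of_tendsto_nhds
      (((continuous_remainderIntegral T (Real.log x)).tendsto 1).const_sub B)
  simp only [Real.rpow_one] at h1
  refine le_of_tendsto_of_tendsto h1 h2 ?_
  filter_upwards [self_mem_nhdsWithin] with σ hσ
  have hσ : 1 < σ := hσ
  obtain ⟨-, s2, s3⟩ := summable_and_tsum_fejer hT (Real.log x) hσ
  have h3 := s2.sum_le_tsum W fun n _ =>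
    mul_nonneg (re_term_nonneg (fun _ => zero_le_one) σ n) (fejer_nonneg hT _)
  rw [s3] at h3
  have h4 := tsum_vonMangoldt_fejer_le hC hT hη hx hσ
  have h5 : ∑ n ∈ W, (LSeries.term (fun _ => ((1 : ℝ) : ℂ)) σ n).re * fejer T (Real.log n - Real.log x)
      = ∑ n ∈ W, (1 / (n : ℝ) ^ σ) * fejer T (Real.log n - Real.log x) :=
    Finset.sum_congr rfl fun n hn => by rw [re_term_ofReal (fun _ => 1) σ (hW n hn)]
  rw [h5] at h3
  linarith

lemma le_sum_window_fejer {T x : ℝ} (hT : 1 ≤ T) (hx : 2 * T ≤ x) :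
    1 / 16 ≤ ∑ n ∈ Finset.Ioc ⌊x⌋₊ ⌊x * (1 + 1 / T)⌋₊,
      (1 / (n : ℝ)) * fejer T (Real.log n - Real.log x) := by
  have hT0 : 0 < T := by linarith
  have hx0 : 0 < x := by linarith
  have h1T : 1 / T ≤ 1 := by rw [div_le_one hT0]; exact hT
  have h : ∀ n ∈ Finset.Ioc ⌊x⌋₊ ⌊x * (1 + 1 / T)⌋₊,
      1 / (2 * x) * (T / 4) ≤ (1 / (n : ℝ)) * fejer T (Real.log n - Real.log x) := by
    intro n hn
    rw [Finset.mem_Ioc, Nat.floor_lt hx0.le, Nat.le_floor_iff (by positivity)] at hn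
    obtain ⟨h1, h2⟩ := hn
    have hn0 : (0 : ℝ) < n := hx0.trans h1
    have h3 : |Real.log n - Real.log x| ≤ 1 / T := by
      rw [abs_of_nonneg (sub_nonneg.2 (Real.log_le_log hx0 h1.le)), ← Real.log_div hn0.ne' hx0.ne']
      refine (Real.log_le_sub_one_of_pos (by positivity)).trans ?_
      rw [sub_le_iff_le_add, div_le_iff₀ hx0]
      linarith
    have h4 := le_fejer hT0 h3
    have h5 : (n : ℝ) ≤ 2 * x := by nlinarith
    gcongr
  refine le_trans ?_ (Finset.card_nsmul_le_sum _ _ _ h)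
  rw [nsmul_eq_mul, Nat.card_Ioc]
  have hcard : x / (2 * T) ≤ ((⌊x * (1 + 1 / T)⌋₊ - ⌊x⌋₊ : ℕ) : ℝ) := by
    have h1 := Nat.lt_floor_add_one (x * (1 + 1 / T))
    have h2 := Nat.floor_le hx0.le
    have h3 : (⌊x * (1 + 1 / T)⌋₊ : ℝ) - ⌊x⌋₊ ≤ ((⌊x * (1 + 1 / T)⌋₊ - ⌊x⌋₊ : ℕ) : ℝ) := by
      rw [sub_le_iff_le_add]
      exact_mod_cast (le_tsub_add : _ ≤ (⌊x * (1 + 1 / T)⌋₊ - ⌊x⌋₊) + ⌊x⌋₊)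
    have h4 : x * (1 + 1 / T) = x + x / (2 * T) + x / (2 * T) := by field_simp; ring
    have h5 : 1 ≤ x / (2 * T) := by rw [le_div_iff₀ (by positivity)]; linarith
    linarith
  calc (1 : ℝ) / 16 = x / (2 * T) * (1 / (2 * x) * (T / 4)) := by field_simp; norm_num
    _ ≤ _ := by gcongr

lemma exists_pos_mul_le_psi_sub {η : ℝ} (hη : 0 < η) : ∃ c : ℝ, 0 < c ∧ ∀ᶠ x : ℝ in atTop,
    c * x ≤ Chebyshev.psi (x * Real.exp η) - Chebyshev.psi (x * Real.exp (-(2 * η))) := by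
  obtain ⟨C, hC0, hC⟩ := exists_sum_vonMangoldt_div_le
  set K := 2 * (1 + 1 / η ^ 2) * C with hK
  have hK0 : 0 < K := by positivity
  set T := max 1 (64 * K) with hTdef
  have hT1 : 1 ≤ T := le_max_left _ _
  have hT0 : 0 < T := by linarith
  have hTK : 2 / T * (1 + 1 / η ^ 2) * C ≤ 1 / 64 := by
    have : 2 / T * (1 + 1 / η ^ 2) * C = K / T := by rw [hK]; ring
    rw [this, div_le_iff₀ hT0]
    have := le_max_right 1 (64 * K)
    linarith
  refine ⟨1 / (32 * T * Real.exp η), by positivity, ?_⟩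
  have hR := (tendsto_remainderIntegral T hT0).comp Real.tendsto_log_atTop
  filter_upwards [hR.eventually (lt_mem_nhds (show (-(1 / 64) : ℝ) < 0 by norm_num)),
    eventually_ge_atTop (2 * T)] with x h1 h2
  have hx0 : 0 < x := by linarith
  simp only [Function.comp_apply] at h1
  have h3 := le_sum_window_fejer hT1 h2
  have h4 := sum_window_fejer_le hC hT0 hη hx0 (Finset.Ioc ⌊x⌋₊ ⌊x * (1 + 1 / T)⌋₊)
    (fun n hn => by have := (Finset.mem_Ioc.1 hn).1; omega)
  set D := Chebyshev.psi (x * Real.exp η) - Chebyshev.psi (x * Real.exp (-(2 * η)))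
  have h5 : 1 / 32 ≤ Real.exp η / x * D * T := by linarith
  have h6 : Real.exp η / x * D * T = D * (T * Real.exp η) / x := by ring
  rw [h6, le_div_iff₀ hx0] at h5
  have hE := Real.exp_pos η
  rw [one_div_mul_eq_div, div_le_iff₀ (by positivity)]
  linarith

/-- For every `ε > 0` there is a prime in `[x, (1 + ε) x]` once `x` is large. -/
lemma eventually_exists_prime_mem {ε : ℝ} (hε : 0 < ε) : ∀ᶠ x : ℝ in atTop,
    ∃ p : ℕ, p.Prime ∧ x ≤ p ∧ (p : ℝ) ≤ (1 + ε) * x := by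
  set η := Real.log (1 + ε) / 3 with hη
  have hη0 : 0 < η := div_pos (Real.log_pos (by linarith)) (by norm_num)
  have hη3 : Real.exp (3 * η) = 1 + ε := by
    rw [hη, mul_div_cancel₀ _ (by norm_num), Real.exp_log (by linarith)]
  obtain ⟨c, hc, h⟩ := exists_pos_mul_le_psi_sub hη0
  have hmap : Tendsto (fun x : ℝ => x * Real.exp (2 * η)) atTop atTop :=
    tendsto_id.atTop_mul_const (Real.exp_pos _)
  have hsmall : ∀ᶠ x : ℝ in atTop, 2 * x.sqrt * x.log < c / (4 * (1 + ε)) * x := by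
    have h1 := (isLittleO_log_rpow_atTop (show (0 : ℝ) < 1 / 2 by norm_num)).bound
      (show 0 < c / (16 * (1 + ε)) by positivity)
    filter_upwards [h1, eventually_gt_atTop 1] with x h1 hx
    have hl := Real.log_pos hx
    have hx0 : 0 < x := by linarith
    rw [← Real.sqrt_eq_rpow, Real.norm_of_nonneg hl.le, Real.norm_of_nonneg (Real.sqrt_nonneg _)] at h1
    have hs := Real.sqrt_pos.2 hx0
    have hss := Real.mul_self_sqrt hx0.le
    calc 2 * x.sqrt * x.log ≤ 2 * x.sqrt * (c / (16 * (1 + ε)) * x.sqrt) := by gcongr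
      _ = c / (8 * (1 + ε)) * (x.sqrt * x.sqrt) := by
        have : c / (8 * (1 + ε)) = 2 * (c / (16 * (1 + ε))) := by field_simp; norm_num
        rw [this]; ring
      _ = c / (8 * (1 + ε)) * x := by rw [hss]
      _ < _ := by
        gcongr
        linarith
  have hmul : Tendsto (fun x : ℝ => (1 + ε) * x) atTop atTop :=
    tendsto_id.const_mul_atTop (by linarith)
  filter_upwards [hmap.eventually h, hsmall, hmul.eventually hsmall, eventually_gt_atTop 1]
    with x h1 h2 h3 hx
  have e1 : x * Real.exp (2 * η) * Real.exp η = (1 + ε) * x := by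
    rw [mul_assoc, ← Real.exp_add, ← hη3]; ring_nf
  have e2 : x * Real.exp (2 * η) * Real.exp (-(2 * η)) = x := by
    rw [mul_assoc, ← Real.exp_add]; simp
  rw [e1, e2] at h1
  have hx1 : 1 ≤ (1 + ε) * x := by nlinarith
  have h4 := abs_le.1 (Chebyshev.abs_psi_sub_theta_le_sqrt_mul_log hx.le)
  have h5 := abs_le.1 (Chebyshev.abs_psi_sub_theta_le_sqrt_mul_log hx1)
  have h6 : c * x ≤ c * (x * Real.exp (2 * η)) := by
    have := Real.one_le_exp (show 0 ≤ 2 * η by linarith)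
    exact mul_le_mul_of_nonneg_left (le_mul_of_one_le_right (by linarith) this) hc.le
  have h7 : c / (4 * (1 + ε)) * x ≤ c / 4 * x := by
    gcongr
    linarith
  have h8 : c / (4 * (1 + ε)) * ((1 + ε) * x) = c / 4 * x := by field_simp
  have hcx : 0 < c * x := by positivity
  have h9 : Chebyshev.theta x < Chebyshev.theta ((1 + ε) * x) := by linarith [h4.1, h4.2, h5.1, h5.2]
  by_contra hno
  push Not at hno
  refine absurd h9 (not_lt.2 (le_of_eq ?_))
  rw [Chebyshev.theta, Chebyshev.theta]
  refine Finset.sum_congr ?_ fun _ _ => rfl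
  ext p
  simp only [Finset.mem_filter, Finset.mem_Ioc]
  have hle : x ≤ (1 + ε) * x := by nlinarith
  constructor
  · rintro ⟨⟨a, b⟩, hp⟩
    refine ⟨⟨a, ?_⟩, hp⟩
    by_contra hb
    have hb' : x < p := by rwa [not_le, Nat.floor_lt (by linarith)] at hb
    have := hno p hp hb'.le
    rw [Nat.le_floor_iff (by linarith)] at b
    linarith
  · rintro ⟨⟨a, b⟩, hp⟩
    exact ⟨⟨a, b.trans (Nat.floor_le_floor hle)⟩, hp⟩

lemma leastPrime_spec (x : ℝ) : (leastPrime x).Prime ∧ x ≤ leastPrime x := by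
  have hne : {p : ℕ | p.Prime ∧ x ≤ (p : ℝ)}.Nonempty := by
    obtain ⟨p, hp1, hp2⟩ := Nat.exists_infinite_primes ⌈x⌉₊
    exact ⟨p, hp2, (Nat.le_ceil x).trans (by exact_mod_cast hp1)⟩
  exact Nat.sInf_mem hne

lemma tendsto_leastPrime_div {y : ℝ} (hy : 0 < y) :
    Tendsto (fun X : ℝ => (leastPrime (y * X) : ℝ) / X) atTop (𝓝 y) := by
  rw [tendsto_order]
  have hmul : Tendsto (fun X : ℝ => y * X) atTop atTop := tendsto_id.const_mul_atTop hy
  constructor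
  · intro a ha
    filter_upwards [eventually_gt_atTop 0] with X hX
    rw [lt_div_iff₀ hX]
    nlinarith [(leastPrime_spec (y * X)).2]
  · intro b hb
    set ε := (b - y) / (2 * y) with hε
    have hε0 : 0 < ε := div_pos (by linarith) (by positivity)
    filter_upwards [eventually_gt_atTop 0, hmul.eventually (eventually_exists_prime_mem hε0)]
      with X hX ⟨p, hp, h1, h2⟩
    have h3 : leastPrime (y * X) ≤ p := Nat.sInf_le ⟨hp, h1⟩
    have h4 : (leastPrime (y * X) : ℝ) ≤ p := by exact_mod_cast h3
    rw [div_lt_iff₀ hX]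
    have h5 : (1 + ε) * (y * X) = (y + (b - y) / 2) * X := by rw [hε]; field_simp
    nlinarith

lemma exp_mul_eq_pow (N b : ℕ) : Complex.exp (2 * Real.pi * Complex.I * (b : ℂ) / (N : ℂ)) =
    Complex.exp (2 * Real.pi * Complex.I / N) ^ b := by
  rw [← Complex.exp_nat_mul]
  congr 1
  ring

lemma sum_nthRootsFinset_one {n : ℕ} (hn : 1 < n) :
    ∑ ζ ∈ Polynomial.nthRootsFinset n (1 : ℂ), ζ = 0 := by
  have hζ := Complex.isPrimitiveRoot_exp n (by omega)
  set ζ := Complex.exp (2 * Real.pi * Complex.I / n)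
  have hinj : Set.InjOn (fun i => ζ ^ i) (Finset.range n) := fun i hi j hj h =>
    hζ.pow_inj (Finset.mem_range.1 hi) (Finset.mem_range.1 hj) h
  have himg : (Finset.range n).image (fun i => ζ ^ i) = Polynomial.nthRootsFinset n (1 : ℂ) := by
    refine Finset.eq_of_subset_of_card_le (fun z hz => ?_) ?_
    · obtain ⟨i, -, rfl⟩ := Finset.mem_image.1 hz
      rw [Polynomial.mem_nthRootsFinset (by omega), ← pow_mul, mul_comm, pow_mul, hζ.pow_eq_one,
        one_pow]
    · rw [Finset.card_image_of_injOn hinj, hζ.card_nthRootsFinset, Finset.card_range]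
  rw [← himg, Finset.sum_image hinj]
  exact hζ.geom_sum_eq_zero hn

lemma sum_primitiveRoots_eq_moebius {n : ℕ} (hn : 0 < n) :
    ∑ ζ ∈ primitiveRoots n ℂ, ζ = (ArithmeticFunction.moebius n : ℂ) := by
  have h : ∀ m > 0, ∑ d ∈ m.divisors, ∑ ζ ∈ primitiveRoots d ℂ, ζ = if m = 1 then 1 else 0 := by
    intro m hm
    rw [← Finset.sum_biUnion fun i _ j _ hij => IsPrimitiveRoot.disjoint hij,
      ← IsPrimitiveRoot.nthRoots_one_eq_biUnion_primitiveRoots]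
    split_ifs with h1
    · have : Polynomial.nthRootsFinset m (1 : ℂ) = {1} := by
        ext z
        rw [Polynomial.mem_nthRootsFinset hm, h1]
        simp
      simp [this]
    · exact sum_nthRootsFinset_one (by omega)
  rw [ArithmeticFunction.sum_eq_iff_sum_mul_moebius_eq] at h
  rw [← h n hn, Finset.sum_eq_single (n, 1)]
  · simp
  · rintro ⟨a, b⟩ hab hne
    rw [Nat.mem_divisorsAntidiagonal] at hab
    have : b ≠ 1 := by rintro rfl; simp_all
    simp [this]
  · intro h1
    simp [hn.ne'] at h1

lemma sum_coprime_exp_eq_moebius {N : ℕ} (hN : 0 < N) :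
    ∑ b ∈ (Finset.Icc 1 N).filter (fun b => b.Coprime N),
      Complex.exp (2 * Real.pi * Complex.I * (b : ℂ) / (N : ℂ)) =
      (ArithmeticFunction.moebius N : ℂ) := by
  have hζ := Complex.isPrimitiveRoot_exp N hN.ne'
  simp_rw [exp_mul_eq_pow]
  set ζ := Complex.exp (2 * Real.pi * Complex.I / N)
  have hinj : Set.InjOn (fun i => ζ ^ i) ((Finset.Icc 1 N).filter (fun b => b.Coprime N)) := by
    intro i hi j hj h
    simp only [Finset.coe_filter, Finset.mem_Icc, Set.mem_ofPred_eq] at hi hj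
    have h' : ζ ^ i = ζ ^ j := h
    rw [(hζ.isOfFinOrder hN.ne').pow_eq_pow_iff_modEq, ← hζ.eq_orderOf, Nat.ModEq] at h'
    rcases hi.1.2.lt_or_eq with h1 | h1 <;> rcases hj.1.2.lt_or_eq with h2 | h2
    · rwa [Nat.mod_eq_of_lt h1, Nat.mod_eq_of_lt h2] at h'
    · rw [h2, Nat.mod_self, Nat.mod_eq_of_lt h1] at h'
      omega
    · rw [h1, Nat.mod_self, Nat.mod_eq_of_lt h2] at h'
      omega
    · omega
  have himg : ((Finset.Icc 1 N).filter (fun b => b.Coprime N)).image (fun i => ζ ^ i) =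
      primitiveRoots N ℂ := by
    refine Finset.eq_of_subset_of_card_le (fun z hz => ?_) ?_
    · obtain ⟨i, hi, rfl⟩ := Finset.mem_image.1 hz
      rw [mem_primitiveRoots hN]
      exact hζ.pow_of_coprime i (Finset.mem_filter.1 hi).2
    · rw [Finset.card_image_of_injOn hinj, Complex.card_primitiveRoots,
        ← Nat.filter_coprime_Ico_eq_totient N 1, add_comm 1 N, Finset.Ico_add_one_right_eq_Icc]
      simp_rw [Nat.coprime_comm]
      exact le_rfl
  rw [← sum_primitiveRoots_eq_moebius hN, ← himg, Finset.sum_image hinj]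

lemma sum_Icc_eq_sum_zmod {N : ℕ} [NeZero N] {M : Type*} [AddCommMonoid M] (f : ZMod N → M) :
    ∑ b ∈ Finset.Icc 1 N, f (b : ZMod N) = ∑ x : ZMod N, f x := by
  refine Finset.sum_bij (fun b _ => (b : ZMod N)) (fun _ _ => Finset.mem_univ _) ?_ ?_
    fun _ _ => rfl
  · intro a ha b hb h
    rw [Finset.mem_Icc] at ha hb
    rw [ZMod.natCast_eq_natCast_iff'] at h
    rcases ha.2.lt_or_eq with h1 | h1 <;> rcases hb.2.lt_or_eq with h2 | h2
    · rwa [Nat.mod_eq_of_lt h1, Nat.mod_eq_of_lt h2] at h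
    · rw [h2, Nat.mod_self, Nat.mod_eq_of_lt h1] at h
      omega
    · rw [h1, Nat.mod_self, Nat.mod_eq_of_lt h2] at h
      omega
    · omega
  · intro x _
    have hN := NeZero.pos N
    rcases Nat.eq_zero_or_pos x.val with h | h
    · refine ⟨N, Finset.mem_Icc.2 ⟨hN, le_rfl⟩, ?_⟩
      rw [ZMod.natCast_self, eq_comm, ← ZMod.val_eq_zero, h]
    · exact ⟨x.val, Finset.mem_Icc.2 ⟨h, (ZMod.val_lt x).le⟩, ZMod.natCast_zmod_val x⟩

lemma stdAddChar_natCast {N : ℕ} [NeZero N] (b : ℕ) : ZMod.stdAddChar (b : ZMod N) =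
    Complex.exp (2 * Real.pi * Complex.I * (b : ℂ) / (N : ℂ)) := by
  simpa using ZMod.stdAddChar_coe (N := N) b

lemma gaussSum'_eq {N : ℕ} [NeZero N] (χ : DirichletCharacter ℂ N) :
    gaussSum' χ = gaussSum χ ZMod.stdAddChar := by
  rw [gaussSum', gaussSum, ← sum_Icc_eq_sum_zmod]
  simp_rw [stdAddChar_natCast]

lemma gaussSumConj_eq {N : ℕ} [NeZero N] (χ : DirichletCharacter ℂ N) :
    gaussSumConj χ = gaussSum χ⁻¹ ZMod.stdAddChar := by
  rw [gaussSumConj, gaussSum, ← sum_Icc_eq_sum_zmod]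
  simp_rw [stdAddChar_natCast, ← MulChar.star_apply', starRingEnd_apply]

lemma gaussSumConj_one {N : ℕ} (hN : 0 < N) :
    gaussSumConj (1 : DirichletCharacter ℂ N) = (ArithmeticFunction.moebius N : ℂ) := by
  rw [gaussSumConj, ← sum_coprime_exp_eq_moebius hN, Finset.sum_filter]
  refine Finset.sum_congr rfl fun b _ => ?_
  split_ifs with h
  · rw [MulChar.one_apply ((ZMod.isUnit_iff_coprime b N).2 h)]
    simp
  · rw [MulChar.map_nonunit _ (mt (ZMod.isUnit_iff_coprime b N).1 h)]
    simp

lemma gaussSum_mul_gaussSum_inv {N : ℕ} [NeZero N] {χ : DirichletCharacter ℂ N}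
    (hχ : χ.IsPrimitive) :
    gaussSum χ ZMod.stdAddChar * gaussSum χ⁻¹ ZMod.stdAddChar = N * χ (-1) := by
  have h1 : gaussSum χ ZMod.stdAddChar * gaussSum χ⁻¹ ZMod.stdAddChar =
      ∑ a : ZMod N, ∑ b : ZMod N, χ b * ZMod.stdAddChar (a * (b + 1)) := by
    rw [gaussSum, gaussSum, Finset.mul_sum, ← gaussSum]
    refine Finset.sum_congr rfl fun a _ => ?_
    rw [← mul_assoc, mul_comm (gaussSum _ _), ← gaussSum_mulShift_of_isPrimitive _ hχ, gaussSum,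
      Finset.sum_mul]
    refine Finset.sum_congr rfl fun b _ => ?_
    rw [AddChar.mulShift_apply, mul_assoc, ← AddChar.map_add_eq_mul, mul_add, mul_one]
  rw [h1, Finset.sum_comm]
  simp_rw [← Finset.mul_sum, AddChar.sum_mulShift _ (ZMod.isPrimitive_stdAddChar N)]
  rw [Finset.sum_eq_single (-1)]
  · simp [mul_comm]
  · intro b _ hb
    rw [if_neg (fun h => hb (eq_neg_of_add_eq_zero_left h))]
    simp
  · simp

lemma div_gaussSum'_eq {N : ℕ} [NeZero N] {χ : DirichletCharacter ℂ N} (hχ : χ.IsPrimitive)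
    (he : χ (-1) = 1) (z : ℂ) : z / gaussSum' χ = 1 / N * (gaussSumConj χ * z) := by
  have h := gaussSum_mul_gaussSum_inv hχ
  rw [he, mul_one, ← gaussSum'_eq, ← gaussSumConj_eq] at h
  have hN : (N : ℂ) ≠ 0 := NeZero.ne _
  have h0 : gaussSum' χ ≠ 0 := fun h0 => hN (by rw [← h, h0, zero_mul])
  rw [← h] at hN ⊢
  field_simp
  rw [mul_div_assoc, div_self (right_ne_zero_of_mul hN), mul_one]

/-- Orthogonality over the even characters, applied to Gauss sums. -/
lemma sum_even_gaussSumConj_mul {N : ℕ} [NeZero N] {p : ℕ} (hp : p.Coprime N) :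
    ∑ χ : DirichletCharacter ℂ N,
      (if χ (-1) = 1 then gaussSumConj χ * χ (p : ZMod N) else 0) =
      ((N.totient * Real.cos (2 * Real.pi * p / N) : ℝ) : ℂ) := by
  have ha : IsUnit (p : ZMod N) := (ZMod.isUnit_iff_coprime p N).2 hp
  set a : ZMod N := (p : ZMod N) with hadef
  have hterm : ∀ χ : DirichletCharacter ℂ N,
      (if χ (-1) = 1 then gaussSumConj χ * χ a else 0) =
      (1 / 2) * ∑ b : ZMod N, ZMod.stdAddChar b * (χ a * χ⁻¹ b + χ (-a) * χ⁻¹ b) := by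
    intro χ
    have h1 : ∑ b : ZMod N, ZMod.stdAddChar b * (χ a * χ⁻¹ b + χ (-a) * χ⁻¹ b) =
        gaussSumConj χ * (χ a + χ (-1) * χ a) := by
      rw [gaussSumConj_eq, gaussSum, Finset.sum_mul, ← map_mul, neg_one_mul]
      exact Finset.sum_congr rfl fun b _ => by ring
    rw [h1]
    rcases χ.even_or_odd with h | h
    · have h' : χ (-1) = 1 := h
      rw [if_pos h', h']; ring
    · have h' : χ (-1) = -1 := h
      rw [h', if_neg (by norm_num)]; ring
  have hinv : ∀ (χ : DirichletCharacter ℂ N) (c b : ZMod N), IsUnit c →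
      χ c * χ⁻¹ b = star (χ c⁻¹ * χ b) := by
    intro χ c b hc
    rw [star_mul', MulChar.star_apply', MulChar.star_apply', MulChar.inv_apply_eq_inv' χ b,
      MulChar.inv_apply_eq_inv' χ c⁻¹]
    have h2 : χ c⁻¹ = (χ c)⁻¹ := by
      refine eq_inv_of_mul_eq_one_left ?_
      rw [← map_mul, ZMod.inv_mul_of_unit c hc, map_one]
    rw [h2, inv_inv]
  have horth : ∀ c : ZMod N, IsUnit c → ∀ b : ZMod N,
      ∑ χ : DirichletCharacter ℂ N, χ c * χ⁻¹ b = if c = b then (N.totient : ℂ) else 0 := by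
    intro c hc b
    simp_rw [hinv _ c b hc]
    rw [← star_sum, DirichletCharacter.sum_char_inv_mul_char_eq ℂ hc b]
    split_ifs <;> simp
  simp_rw [hterm]
  rw [← Finset.mul_sum, Finset.sum_comm]
  simp_rw [← Finset.mul_sum, Finset.sum_add_distrib, horth a ha, horth (-a) ha.neg, mul_add,
    Finset.sum_add_distrib, mul_ite, mul_zero, Finset.sum_ite_eq, Finset.mem_univ, if_true]
  have h3 : ZMod.stdAddChar a = Complex.exp ((2 * Real.pi * p / N : ℝ) * Complex.I) := by
    rw [hadef, stdAddChar_natCast]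
    push_cast
    congr 1
    ring
  rw [AddChar.map_neg_eq_inv, h3, ← Complex.exp_neg, ← neg_mul]
  push_cast
  rw [Complex.cos]
  ring

/-- The combined contribution of modulus `N` to `Q̃₊ + Ẽ₊`. -/
lemma finsum_primitive_add_finsum_imprimitive {N : ℕ} (hN : 2 ≤ N) (p : ℕ) :
    (∑ᶠ χ ∈ {χ : DirichletCharacter ℂ N | χ.IsPrimitive ∧ χ (-1) = 1},
        χ (p : ZMod N) / gaussSum' χ) +
      (Complex.ofReal (1 / (N : ℝ))) *
        ∑ᶠ χ ∈ {χ : DirichletCharacter ℂ N | ¬χ.IsPrimitive ∧ χ ≠ 1 ∧ χ (-1) = 1},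
          gaussSumConj χ * χ (p : ZMod N) =
    ((if p.Coprime N then
      1 / (N : ℝ) * (N.totient * Real.cos (2 * Real.pi * p / N) - ArithmeticFunction.moebius N)
      else 0 : ℝ) : ℂ) := by
  classical
  have : NeZero N := ⟨by omega⟩
  have hfin : ∀ (S : Set (DirichletCharacter ℂ N)) (f : DirichletCharacter ℂ N → ℂ),
      ∑ᶠ χ ∈ S, f χ = ∑ χ, if χ ∈ S then f χ else 0 := by
    intro S f
    rw [finsum_mem_def, finsum_eq_sum_of_fintype]
    exact Finset.sum_congr rfl fun χ _ => by rw [Set.indicator_apply]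
  rw [hfin, hfin]
  split_ifs with hp
  · rw [Finset.mul_sum, ← Finset.sum_add_distrib]
    have hone : (1 : DirichletCharacter ℂ N) (p : ZMod N) = 1 :=
      MulChar.one_apply ((ZMod.isUnit_iff_coprime p N).2 hp)
    have hterm : ∀ χ : DirichletCharacter ℂ N,
        (if χ ∈ {χ : DirichletCharacter ℂ N | χ.IsPrimitive ∧ χ (-1) = 1} then
          χ (p : ZMod N) / gaussSum' χ else 0) + (Complex.ofReal (1 / (N : ℝ))) *
        (if χ ∈ {χ : DirichletCharacter ℂ N | ¬χ.IsPrimitive ∧ χ ≠ 1 ∧ χ (-1) = 1} then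
          gaussSumConj χ * χ (p : ZMod N) else 0) =
        1 / (N : ℂ) * ((if χ (-1) = 1 then gaussSumConj χ * χ (p : ZMod N) else 0) -
          if χ = 1 then (ArithmeticFunction.moebius N : ℂ) else 0) := by
      intro χ
      by_cases h1 : χ = 1
      · subst h1
        have hnp : ¬ (1 : DirichletCharacter ℂ N).IsPrimitive := by
          rw [DirichletCharacter.isPrimitive_def, DirichletCharacter.conductor_one]
          omega
        have hneg : (1 : DirichletCharacter ℂ N) (-1) = 1 := MulChar.one_apply isUnit_one.neg
        simp [hnp, hneg, hone, gaussSumConj_one (show 0 < N by omega)]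
      · by_cases he : χ (-1) = 1
        · by_cases hpr : χ.IsPrimitive
          · simp [hpr, he, h1, div_gaussSum'_eq hpr he]
          · simp [hpr, he, h1]
        · simp [he, h1]
    refine (Finset.sum_congr rfl fun χ _ => by convert hterm χ).trans ?_
    rw [← Finset.mul_sum, Finset.sum_sub_distrib, sum_even_gaussSumConj_mul hp]
    simp
  · have hz : ∀ χ : DirichletCharacter ℂ N, χ (p : ZMod N) = 0 := fun χ =>
      χ.map_nonunit (mt (ZMod.isUnit_iff_coprime p N).1 hp)
    simp [hz]

/-- The Möbius function restricted to odd integers. -/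
noncomputable def oddMoebius (d : ℕ) : ℝ := if Odd d then (ArithmeticFunction.moebius d : ℝ) else 0

lemma abs_oddMoebius_le_one (d : ℕ) : |oddMoebius d| ≤ 1 := by
  rw [oddMoebius]
  split_ifs
  · exact_mod_cast ArithmeticFunction.abs_moebius_le_one (n := d)
  · simp

lemma totient_div_eq_sum {m : ℕ} (hm : 0 < m) :
    (m.totient : ℝ) / m = ∑ d ∈ m.divisors, (ArithmeticFunction.moebius d : ℝ) / d := by
  have h : ∀ n : ℕ, n > 0 → ∑ i ∈ n.divisors, (i.totient : ℝ) = (n : ℝ) := fun n _ => by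
    exact_mod_cast Nat.sum_totient n
  rw [ArithmeticFunction.sum_eq_iff_sum_mul_moebius_eq] at h
  have hm' : (m : ℝ) ≠ 0 := by exact_mod_cast hm.ne'
  rw [← h m hm, Nat.sum_divisorsAntidiagonal (fun a b => (ArithmeticFunction.moebius a : ℝ) * b),
    Finset.sum_div]
  refine Finset.sum_congr rfl fun d hd => ?_
  have hdvd := Nat.dvd_of_mem_divisors hd
  have hd0 : (d : ℝ) ≠ 0 := by exact_mod_cast (Nat.pos_of_mem_divisors hd).ne'
  rw [Nat.cast_div hdvd hd0]
  field_simp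

lemma sum_oddMoebius_div {N : ℕ} (hN : 0 < N) :
    (N.totient : ℝ) / N =
      (∑ d ∈ N.divisors, oddMoebius d / d) * (if 2 ∣ N then 1 / 2 else 1) := by
  obtain ⟨k, m, hm, rfl⟩ := Nat.exists_eq_two_pow_mul_odd hN.ne'
  have hm0 : 0 < m := hm.pos
  have hsum : ∑ d ∈ (2 ^ k * m).divisors, oddMoebius d / d = (m.totient : ℝ) / m := by
    rw [totient_div_eq_sum hm0]
    simp only [oddMoebius, ite_div, zero_div]
    rw [← Finset.sum_filter]
    refine Finset.sum_congr ?_ fun _ _ => rfl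
    ext d
    simp only [Finset.mem_filter, Nat.mem_divisors]
    constructor
    · rintro ⟨⟨h1, -⟩, h2⟩
      refine ⟨Nat.Coprime.dvd_of_dvd_mul_left ?_ h1, hm0.ne'⟩
      exact (Nat.coprime_two_right.2 h2).pow_right k
    · rintro ⟨h1, -⟩
      exact ⟨⟨h1.mul_left _, hN.ne'⟩, hm.of_dvd_nat h1⟩
  rw [hsum, Nat.totient_mul ((Nat.coprime_two_left.2 hm).pow_left k)]
  have hm' : (m : ℝ) ≠ 0 := by exact_mod_cast hm0.ne'
  rcases Nat.eq_zero_or_pos k with rfl | hk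
  · have : ¬ 2 ∣ 2 ^ 0 * m := by
      rw [pow_zero, one_mul, ← even_iff_two_dvd, Nat.not_even_iff_odd]; exact hm
    rw [if_neg this]
    simp
  · have : 2 ∣ 2 ^ k * m := (dvd_pow_self 2 hk.ne').mul_right m
    rw [if_pos this, Nat.totient_prime_pow Nat.prime_two hk]
    obtain ⟨j, rfl⟩ := Nat.exists_eq_add_of_lt hk
    simp only [zero_add, Nat.add_sub_cancel]
    push_cast
    rw [pow_succ]
    field_simp

lemma summable_moebius_div_sq : Summable fun n : ℕ => (ArithmeticFunction.moebius n : ℝ) / (n : ℝ) ^ 2 := by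
  refine Summable.of_norm_bounded (Real.summable_one_div_nat_pow.2 one_lt_two) fun n => ?_
  rw [norm_div, norm_pow, Real.norm_natCast]
  gcongr
  rw [Real.norm_eq_abs]
  exact_mod_cast ArithmeticFunction.abs_moebius_le_one (n := n)

lemma summable_oddMoebius_div_sq : Summable fun n : ℕ => oddMoebius n / (n : ℝ) ^ 2 := by
  refine Summable.of_norm_bounded (Real.summable_one_div_nat_pow.2 one_lt_two) fun n => ?_
  rw [norm_div, norm_pow, Real.norm_natCast]
  gcongr
  exact abs_oddMoebius_le_one n

lemma tsum_moebius_div_sq :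
    ∑' n : ℕ, (ArithmeticFunction.moebius n : ℝ) / (n : ℝ) ^ 2 = 6 / Real.pi ^ 2 := by
  have h2 : 1 < (2 : ℂ).re := by norm_num
  have h := ArithmeticFunction.LSeries_zeta_mul_Lseries_moebius h2
  rw [ArithmeticFunction.LSeries_zeta_eq_riemannZeta h2, riemannZeta_two] at h
  have h3 : LSeries (fun n => ((ArithmeticFunction.moebius n : ℤ) : ℂ)) 2 =
      ((∑' n : ℕ, (ArithmeticFunction.moebius n : ℝ) / (n : ℝ) ^ 2 : ℝ) : ℂ) := by
    rw [LSeries, Complex.ofReal_tsum]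
    refine tsum_congr fun n => ?_
    rcases eq_or_ne n 0 with rfl | hn
    · simp
    · rw [LSeries.term_of_ne_zero hn]
      push_cast
      norm_cast
  rw [h3] at h
  have h4 : Real.pi ^ 2 / 6 * ∑' n : ℕ, (ArithmeticFunction.moebius n : ℝ) / (n : ℝ) ^ 2 = 1 := by
    exact_mod_cast h
  have := Real.pi_ne_zero
  field_simp at h4 ⊢
  linarith

lemma moebius_two_mul (k : ℕ) : (ArithmeticFunction.moebius (2 * k) : ℝ) = -oddMoebius k := by
  rw [oddMoebius]
  split_ifs with h
  · rw [ArithmeticFunction.isMultiplicative_moebius.map_mul_of_coprime (Nat.coprime_two_left.2 h),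
      ArithmeticFunction.moebius_apply_prime Nat.prime_two]
    push_cast; ring
  · rw [ArithmeticFunction.moebius_eq_zero_of_not_squarefree]
    · simp
    · intro hs
      obtain ⟨j, rfl⟩ := even_iff_two_dvd.1 (Nat.not_odd_iff_even.1 h)
      have := hs 2 ⟨j, by ring⟩
      norm_num at this

lemma tsum_even_add_tsum_odd {f : ℕ → ℝ} (hf : Summable f) :
    ∑' k, f (2 * k) + ∑' k, f (2 * k + 1) = ∑' n, f n :=
  tsum_even_add_odd
    (hf.comp_injective (i := fun k => 2 * k) fun a b h => by simpa using h)
    (hf.comp_injective (i := fun k => 2 * k + 1) fun a b h => by simpa using h)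

lemma tsum_oddMoebius_div_sq : ∑' n : ℕ, oddMoebius n / (n : ℝ) ^ 2 = 8 / Real.pi ^ 2 := by
  have e1 := tsum_even_add_tsum_odd summable_moebius_div_sq
  have e2 := tsum_even_add_tsum_odd summable_oddMoebius_div_sq
  have e3 : ∀ k : ℕ, (ArithmeticFunction.moebius (2 * k) : ℝ) / ((2 * k : ℕ) : ℝ) ^ 2 =
      -(1 / 4) * (oddMoebius k / (k : ℝ) ^ 2) := by
    intro k
    rw [moebius_two_mul]
    push_cast
    rw [mul_pow, neg_div, mul_comm ((2 : ℝ) ^ 2), ← div_div]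
    ring
  have e4 : ∀ k : ℕ, oddMoebius (2 * k) / ((2 * k : ℕ) : ℝ) ^ 2 = 0 := by
    intro k
    rw [oddMoebius, if_neg (by simp), zero_div]
  have e5 : ∀ k : ℕ, oddMoebius (2 * k + 1) / ((2 * k + 1 : ℕ) : ℝ) ^ 2 =
      (ArithmeticFunction.moebius (2 * k + 1) : ℝ) / ((2 * k + 1 : ℕ) : ℝ) ^ 2 := by
    intro k
    rw [oddMoebius, if_pos (by simp)]
  rw [tsum_congr e3, tsum_mul_left, tsum_moebius_div_sq] at e1
  rw [tsum_congr e4, tsum_congr e5, tsum_zero, zero_add] at e2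
  rw [e2] at e1
  have : ∑' n : ℕ, oddMoebius n / (n : ℝ) ^ 2 = 4 / 3 * (6 / Real.pi ^ 2) := by linarith
  rw [this]
  ring

lemma abs_card_dvd_sub_le {X H : ℝ} (hX : 0 < X) (hH : 0 ≤ H) {m : ℕ} (hm : 0 < m) :
    |(((Finset.Icc ⌈X⌉₊ ⌊X + H⌋₊).filter (fun N => m ∣ N)).card : ℝ) - H / m| ≤ 2 := by
  obtain ⟨a, ha⟩ : ∃ a, ⌈X⌉₊ = a + 1 := Nat.exists_eq_add_one.2 (Nat.ceil_pos.2 hX)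
  have h1 : (a : ℝ) < X := Nat.lt_ceil.1 (by omega)
  have h2 : X ≤ a + 1 := by
    have := Nat.le_ceil X
    rw [ha] at this
    exact_mod_cast this
  set b := ⌊X + H⌋₊ with hb
  have h3 : (b : ℝ) ≤ X + H := Nat.floor_le (by linarith)
  have h4 : X + H < b + 1 := Nat.lt_floor_add_one _
  have hm' : (0 : ℝ) < m := by exact_mod_cast hm
  have h5 : ((Finset.Icc ⌈X⌉₊ b).filter (fun N => m ∣ N)).card + a / m = b / m := by
    rw [← Nat.Ioc_filter_dvd_card_eq_div, ← Nat.Ioc_filter_dvd_card_eq_div,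
      ← Finset.card_union_of_disjoint]
    · congr 1
      ext N
      simp only [Finset.mem_union, Finset.mem_filter, Finset.mem_Icc, Finset.mem_Ioc, ha]
      have hab : a ≤ b := by
        rw [hb]
        exact Nat.le_floor (by linarith)
      constructor
      · rintro (⟨⟨p, q⟩, r⟩ | ⟨⟨p, q⟩, r⟩)
        · exact ⟨⟨by omega, q⟩, r⟩
        · exact ⟨⟨p, by omega⟩, r⟩
      · rintro ⟨⟨p, q⟩, r⟩
        rcases Nat.lt_or_ge a N with h | h
        · exact Or.inl ⟨⟨h, q⟩, r⟩
        · exact Or.inr ⟨⟨p, h⟩, r⟩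
    · rw [Finset.disjoint_left]
      intro N hN hN'
      simp only [Finset.mem_filter, Finset.mem_Icc, Finset.mem_Ioc, ha] at hN hN'
      omega
  have h5' : (((Finset.Icc ⌈X⌉₊ b).filter (fun N => m ∣ N)).card : ℝ) + ((a / m : ℕ) : ℝ) =
      ((b / m : ℕ) : ℝ) := by exact_mod_cast h5
  have key : ∀ c : ℕ, (c : ℝ) + 1 ≤ m * ((c / m : ℕ) : ℝ) + m ∧ m * ((c / m : ℕ) : ℝ) ≤ c := by
    intro c
    have e1 := Nat.div_add_mod c m
    have e2 := Nat.mod_lt c hm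
    constructor
    · have : c + 1 ≤ m * (c / m) + m := by omega
      exact_mod_cast this
    · have : m * (c / m) ≤ c := by omega
      exact_mod_cast this
  obtain ⟨k1, k2⟩ := key a
  obtain ⟨k3, k4⟩ := key b
  set n := (((Finset.Icc ⌈X⌉₊ b).filter (fun N => m ∣ N)).card : ℝ)
  have h6 : n - H / m = (m * n - H) / m := by field_simp
  have h7 : m * n = m * ((b / m : ℕ) : ℝ) - m * ((a / m : ℕ) : ℝ) := by rw [← h5']; ring
  rw [h6, abs_div, abs_of_pos hm', div_le_iff₀ hm', abs_le]
  constructor <;> linarith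

lemma sum_sum_divisors_eq {X H : ℝ} (hX : 0 < X) {k : ℕ} (hk : ∀ d, Odd d → k.Coprime d) :
    ∑ N ∈ (Finset.Icc ⌈X⌉₊ ⌊X + H⌋₊).filter (fun N => k ∣ N), ∑ d ∈ N.divisors, oddMoebius d / d =
      ∑ d ∈ Finset.Icc 1 ⌊X + H⌋₊, oddMoebius d / d *
        ((Finset.Icc ⌈X⌉₊ ⌊X + H⌋₊).filter (fun N => k * d ∣ N)).card := by
  have hpos : 0 < ⌈X⌉₊ := Nat.ceil_pos.2 hX
  have h1 : ∀ N ∈ (Finset.Icc ⌈X⌉₊ ⌊X + H⌋₊).filter (fun N => k ∣ N),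
      ∑ d ∈ N.divisors, oddMoebius d / d =
        ∑ d ∈ Finset.Icc 1 ⌊X + H⌋₊, if d ∣ N then oddMoebius d / d else 0 := by
    intro N hN
    simp only [Finset.mem_filter, Finset.mem_Icc] at hN
    rw [← Finset.sum_filter]
    refine Finset.sum_congr ?_ fun _ _ => rfl
    ext d
    simp only [Nat.mem_divisors, Finset.mem_filter, Finset.mem_Icc]
    constructor
    · rintro ⟨h, h0⟩
      exact ⟨⟨Nat.pos_of_dvd_of_pos h (by omega), (Nat.le_of_dvd (by omega) h).trans hN.1.2⟩, h⟩
    · rintro ⟨-, h⟩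
      exact ⟨h, by omega⟩
  rw [Finset.sum_congr rfl h1, Finset.sum_comm]
  refine Finset.sum_congr rfl fun d _ => ?_
  rw [← Finset.sum_filter, Finset.sum_const, nsmul_eq_mul, mul_comm]
  by_cases hd : Odd d
  · congr 3
    rw [Finset.filter_filter]
    refine Finset.filter_congr fun N _ => ?_
    exact ⟨fun h => (hk d hd).mul_dvd_of_dvd_of_dvd h.1 h.2,
      fun h => ⟨(dvd_mul_right k d).trans h, (dvd_mul_left d k).trans h⟩⟩
  · simp [oddMoebius, hd]

lemma abs_sum_sum_divisors_sub_le {X H : ℝ} (hX : 0 < X) (hH : 0 ≤ H) {k : ℕ} (hk0 : 0 < k)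
    (hk : ∀ d, Odd d → k.Coprime d) :
    |∑ N ∈ (Finset.Icc ⌈X⌉₊ ⌊X + H⌋₊).filter (fun N => k ∣ N), ∑ d ∈ N.divisors, oddMoebius d / d -
      H / k * ∑ d ∈ Finset.range (⌊X + H⌋₊ + 1), oddMoebius d / (d : ℝ) ^ 2| ≤
        2 * (1 + Real.log ⌊X + H⌋₊) := by
  have h0 : ∑ d ∈ Finset.range (⌊X + H⌋₊ + 1), oddMoebius d / (d : ℝ) ^ 2 =
      ∑ d ∈ Finset.Icc 1 ⌊X + H⌋₊, oddMoebius d / (d : ℝ) ^ 2 := by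
    symm
    refine Finset.sum_subset (fun d hd => ?_) fun d hd hd' => ?_
    · simp only [Finset.mem_Icc, Finset.mem_range] at *
      omega
    · simp only [Finset.mem_Icc, Finset.mem_range] at *
      obtain rfl : d = 0 := by omega
      simp
  rw [sum_sum_divisors_eq hX hk, h0, Finset.mul_sum, ← Finset.sum_sub_distrib]
  refine (Finset.abs_sum_le_sum_abs _ _).trans ?_
  have h2 : (∑ d ∈ Finset.Icc 1 ⌊X + H⌋₊, ((d : ℝ))⁻¹) ≤ 1 + Real.log ⌊X + H⌋₊ := by
    have := harmonic_le_one_add_log ⌊X + H⌋₊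
    rw [harmonic_eq_sum_Icc] at this
    push_cast at this
    exact this
  refine le_trans ?_ (mul_le_mul_of_nonneg_left h2 zero_le_two)
  rw [Finset.mul_sum]
  refine Finset.sum_le_sum fun d hd => ?_
  have hd0 : 0 < d := (Finset.mem_Icc.1 hd).1
  have hd' : (0 : ℝ) < d := by exact_mod_cast hd0
  have hk' : (0 : ℝ) < k := by exact_mod_cast hk0
  have hc := abs_card_dvd_sub_le hX hH (Nat.mul_pos hk0 hd0)
  push_cast at hc
  have e : ∀ c : ℝ, oddMoebius d / d * c - H / k * (oddMoebius d / (d : ℝ) ^ 2) =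
      oddMoebius d * (d : ℝ)⁻¹ * (c - H / (k * d)) := by
    intro c
    field_simp
  rw [e, abs_mul, abs_mul, abs_of_pos (inv_pos.2 hd')]
  calc _ ≤ 1 * (d : ℝ)⁻¹ * 2 := by
        gcongr
        exact abs_oddMoebius_le_one d
    _ = _ := by ring

lemma tendsto_log_two_mul_div_rpow {δ : ℝ} (hδ : 0 < δ) :
    Tendsto (fun X : ℝ => 2 * (1 + Real.log (2 * X)) / X ^ δ) atTop (𝓝 0) := by
  have h1 : Tendsto (fun X : ℝ => Real.log X / X ^ δ) atTop (𝓝 0) :=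
    (isLittleO_log_rpow_atTop hδ).tendsto_div_nhds_zero
  have h2 : Tendsto (fun X : ℝ => (2 * (1 + Real.log 2)) / X ^ δ) atTop (𝓝 0) :=
    (tendsto_rpow_atTop hδ).const_div_atTop _
  have h3 := h2.add (h1.const_mul 2)
  rw [mul_zero, add_zero] at h3
  refine h3.congr' ?_
  filter_upwards [eventually_gt_atTop 0] with X hX
  rw [Real.log_mul two_ne_zero hX.ne']
  ring

lemma tendsto_average_sum_divisors {δ : ℝ} (hδ : δ ∈ Set.Ioo (0 : ℝ) 1) {k : ℕ} (hk0 : 0 < k)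
    (hk : ∀ d, Odd d → k.Coprime d) :
    Tendsto (fun X : ℝ => (∑ N ∈ (Finset.Icc ⌈X⌉₊ ⌊X + X ^ δ⌋₊).filter (fun N => k ∣ N),
      ∑ d ∈ N.divisors, oddMoebius d / d) / X ^ δ) atTop (𝓝 (1 / k * (8 / Real.pi ^ 2))) := by
  have hb : Tendsto (fun X : ℝ => ⌊X + X ^ δ⌋₊ + 1) atTop atTop := by
    refine tendsto_atTop_mono' _ ?_ (tendsto_nat_floor_atTop (α := ℝ))
    filter_upwards [eventually_ge_atTop 0] with X hX
    have : ⌊X⌋₊ ≤ ⌊X + X ^ δ⌋₊ := Nat.floor_mono (by linarith [Real.rpow_nonneg hX δ])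
    omega
  have hm : Tendsto (fun X : ℝ => 1 / (k : ℝ) *
      ∑ d ∈ Finset.range (⌊X + X ^ δ⌋₊ + 1), oddMoebius d / (d : ℝ) ^ 2) atTop
      (𝓝 (1 / k * (8 / Real.pi ^ 2))) := by
    have := summable_oddMoebius_div_sq.hasSum.tendsto_sum_nat
    rw [tsum_oddMoebius_div_sq] at this
    exact (this.comp hb).const_mul _
  refine tendsto_of_tendsto_of_dist hm ?_
  refine squeeze_zero' (Eventually.of_forall fun _ => dist_nonneg) ?_
    (tendsto_log_two_mul_div_rpow hδ.1)
  filter_upwards [eventually_ge_atTop 1] with X hX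
  have hX0 : 0 < X := by linarith
  have hH : 0 < X ^ δ := Real.rpow_pos_of_pos hX0 δ
  have hHX : X ^ δ ≤ X := by
    simpa using Real.rpow_le_rpow_of_exponent_le hX hδ.2.le
  have h := abs_sum_sum_divisors_sub_le hX0 hH.le hk0 hk
  rw [dist_comm, Real.dist_eq, le_div_iff₀ hH]
  calc _ = |∑ N ∈ (Finset.Icc ⌈X⌉₊ ⌊X + X ^ δ⌋₊).filter (fun N => k ∣ N),
        ∑ d ∈ N.divisors, oddMoebius d / d -
      X ^ δ / k * ∑ d ∈ Finset.range (⌊X + X ^ δ⌋₊ + 1), oddMoebius d / (d : ℝ) ^ 2| := by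
        have e : ∀ A S H : ℝ, 0 < H → |A / H - 1 / k * S| * H = |A - H / k * S| := by
          intro A S H hH
          conv_lhs => rw [← abs_of_pos hH, ← abs_mul, abs_of_pos hH]
          congr 1
          field_simp
        exact e _ _ _ hH
    _ ≤ _ := h
    _ ≤ _ := by
        have : 0 < ⌊X + X ^ δ⌋₊ := Nat.floor_pos.2 (by linarith)
        have h' : (⌊X + X ^ δ⌋₊ : ℝ) ≤ X + X ^ δ := Nat.floor_le (by linarith)
        have := Real.log_le_log (by exact_mod_cast this) (h'.trans (by linarith : X + X ^ δ ≤ 2 * X))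
        linarith

lemma sum_totient_div_eq {s : Finset ℕ} (hs : ∀ N ∈ s, 0 < N) (g : ℕ → ℝ)
    (hg : ∀ N, g N = ∑ d ∈ N.divisors, oddMoebius d / d) :
    ∑ N ∈ s.filter (fun N => N % 4 ≠ 2), (N.totient : ℝ) / N =
      ∑ N ∈ s.filter (fun N => 1 ∣ N), g N - ∑ N ∈ s.filter (fun N => 2 ∣ N), g N +
        1 / 2 * ∑ N ∈ s.filter (fun N => 4 ∣ N), g N := by
  simp only [Finset.sum_filter]
  rw [Finset.mul_sum, ← Finset.sum_sub_distrib, ← Finset.sum_add_distrib]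
  refine Finset.sum_congr rfl fun N hN => ?_
  rw [sum_oddMoebius_div (hs N hN), ← hg]
  by_cases h4 : 4 ∣ N
  · have h2 : 2 ∣ N := by omega
    have h : N % 4 ≠ 2 := by omega
    simp [h4, h2, h]
    ring
  · by_cases h2 : 2 ∣ N
    · have h : ¬ (N % 4 ≠ 2) := by omega
      simp [h4, h2, h]
    · have h : N % 4 ≠ 2 := by omega
      simp [h4, h2, h]

/-- The average of `φ(N) / N` over `N ≢ 2 (mod 4)` in the interval `[X, X + X ^ δ]`. -/
lemma tendsto_average_totient_div {δ : ℝ} (hδ : δ ∈ Set.Ioo (0 : ℝ) 1) :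
    Tendsto (fun X : ℝ => (∑ N ∈ (Finset.Icc ⌈X⌉₊ ⌊X + X ^ δ⌋₊).filter (fun N => N % 4 ≠ 2),
      (N.totient : ℝ) / N) / X ^ δ) atTop (𝓝 (5 / Real.pi ^ 2)) := by
  have h1 := tendsto_average_sum_divisors hδ (k := 1) one_pos fun d _ => Nat.coprime_one_left d
  have h2 := tendsto_average_sum_divisors hδ (k := 2) two_pos fun d h => Nat.coprime_two_left.2 h
  have h4 := tendsto_average_sum_divisors hδ (k := 4) four_pos fun d h =>
    (Nat.coprime_two_left.2 h).pow_left 2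
  have h := (h1.sub h2).add (h4.const_mul (1 / 2))
  have e : 1 / ((1 : ℕ) : ℝ) * (8 / Real.pi ^ 2) - 1 / ((2 : ℕ) : ℝ) * (8 / Real.pi ^ 2) +
      1 / 2 * (1 / ((4 : ℕ) : ℝ) * (8 / Real.pi ^ 2)) = 5 / Real.pi ^ 2 := by
    push_cast
    ring
  rw [e] at h
  refine h.congr' ?_
  filter_upwards [eventually_gt_atTop 0] with X hX
  rw [sum_totient_div_eq (fun N hN => (Nat.ceil_pos.2 hX).trans_le (Finset.mem_Icc.1 hN).1) _
    fun _ => rfl]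
  ring

/-- The contribution of the modulus `N` to the sum of `QplusTilde` and `EplusTilde`. -/
noncomputable def modulusTerm (p N : ℕ) : ℝ :=
  if p.Coprime N then
    1 / (N : ℝ) * (N.totient * Real.cos (2 * Real.pi * p / N) - ArithmeticFunction.moebius N)
  else 0

lemma QplusTilde_add_EplusTilde {y X δ : ℝ} (hX : 2 ≤ X) :
    QplusTilde y X δ + EplusTilde y X δ =
      Complex.ofReal ((∑ N ∈ (Finset.Icc ⌈X⌉₊ ⌊X + X ^ δ⌋₊).filter (fun N => N % 4 ≠ 2),
        modulusTerm (leastPrime (y * X)) N) / X ^ δ) := by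
  have hH : 0 ≤ X ^ δ := Real.rpow_nonneg (by linarith) δ
  have hS : (Finset.range (Nat.floor (X + X ^ δ) + 1)).filter
        (fun N : ℕ => 0 < N ∧ X ≤ (N : ℝ) ∧ (N : ℝ) ≤ X + X ^ δ ∧ N % 4 ≠ 2) =
      (Finset.Icc ⌈X⌉₊ ⌊X + X ^ δ⌋₊).filter (fun N => N % 4 ≠ 2) := by
    ext N
    simp only [Finset.mem_filter, Finset.mem_range, Finset.mem_Icc, Nat.ceil_le,
      Nat.le_floor_iff (show (0 : ℝ) ≤ X + X ^ δ by linarith), Nat.lt_succ_iff]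
    constructor
    · rintro ⟨h1, -, h2, -, h3⟩
      exact ⟨⟨h2, h1⟩, h3⟩
    · rintro ⟨⟨h1, h2⟩, h3⟩
      refine ⟨h2, ?_, h1, h2, h3⟩
      have : (0 : ℝ) < N := by linarith
      exact_mod_cast this
  rw [QplusTilde, EplusTilde, hS, ← mul_add, ← Finset.sum_add_distrib,
    div_eq_mul_one_div (Finset.sum _ _ : ℝ), Complex.ofReal_mul,
    mul_comm (Complex.ofReal (Finset.sum _ _)), Complex.ofReal_sum]
  congr 1
  refine Finset.sum_congr rfl fun N hN => ?_
  have hXN : X ≤ N := Nat.ceil_le.1 (Finset.mem_Icc.1 (Finset.mem_filter.1 hN).1).1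
  have hN2 : 2 ≤ N := by
    have : (2 : ℝ) ≤ N := hX.trans hXN
    exact_mod_cast this
  exact finsum_primitive_add_finsum_imprimitive hN2 _

lemma abs_cos_sub_cos_le (a b : ℝ) : |Real.cos a - Real.cos b| ≤ |a - b| := by
  have h := Real.lipschitzWith_cos.dist_le_mul a b
  simpa [Real.dist_eq] using h

lemma abs_modulusTerm_sub_le {p N : ℕ} (hp : p.Prime) (hN : 0 < N) (y : ℝ) :
    |modulusTerm p N - (N.totient : ℝ) / N * Real.cos (2 * Real.pi * y)| ≤
      2 * Real.pi * |(p : ℝ) / N - y| + 1 / N + if p ∣ N then 1 else 0 := by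
  have hN' : (0 : ℝ) < N := by exact_mod_cast hN
  have ht : (N.totient : ℝ) / N ≤ 1 := by
    rw [div_le_one hN']
    exact_mod_cast Nat.totient_le N
  have ht0 : 0 ≤ (N.totient : ℝ) / N := by positivity
  by_cases h : p ∣ N
  · have hc : ¬ p.Coprime N := fun hc => (hp.coprime_iff_not_dvd.1 hc) h
    rw [modulusTerm, if_neg hc, if_pos h, zero_sub, abs_neg, abs_mul, abs_of_nonneg ht0]
    have h1 : (N.totient : ℝ) / N * |Real.cos (2 * Real.pi * y)| ≤ 1 * 1 :=
      mul_le_mul ht (Real.abs_cos_le_one _) (abs_nonneg _) zero_le_one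
    have h2 : 0 ≤ 2 * Real.pi * |(p : ℝ) / N - y| + 1 / N := by positivity
    linarith
  · have hc : p.Coprime N := hp.coprime_iff_not_dvd.2 h
    rw [modulusTerm, if_pos hc, if_neg h, add_zero]
    have e : 1 / (N : ℝ) * (N.totient * Real.cos (2 * Real.pi * p / N) -
        ArithmeticFunction.moebius N) - (N.totient : ℝ) / N * Real.cos (2 * Real.pi * y) =
        (N.totient : ℝ) / N * (Real.cos (2 * Real.pi * p / N) - Real.cos (2 * Real.pi * y)) -
          ArithmeticFunction.moebius N / N := by ring
    rw [e]
    refine (abs_sub _ _).trans (add_le_add ?_ ?_)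
    · rw [abs_mul, abs_of_nonneg ht0]
      refine (mul_le_of_le_one_left (abs_nonneg _) ht).trans ?_
      refine (abs_cos_sub_cos_le _ _).trans (le_of_eq ?_)
      rw [mul_div_assoc, ← mul_sub, abs_mul, abs_of_pos Real.two_pi_pos]
    · rw [abs_div, abs_of_pos hN']
      gcongr
      exact_mod_cast ArithmeticFunction.abs_moebius_le_one (n := N)

lemma abs_div_sub_le {p X H y z : ℝ} (hp : 0 ≤ p) (hX : 0 < X) (h1 : X ≤ z)
    (h2 : z ≤ X + H) : |p / z - y| ≤ |p / X - y| + p / X * (H / X) := by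
  have hz : 0 < z := hX.trans_le h1
  have e : p / z - y = (p / X - y) - p / X * ((z - X) / z) := by
    field_simp
    ring
  rw [e]
  refine (abs_sub _ _).trans (add_le_add_right ?_ _)
  rw [abs_of_nonneg (mul_nonneg (div_nonneg hp hX.le) (div_nonneg (by linarith) hz.le))]
  gcongr <;> linarith

lemma abs_average_modulusTerm_sub_le {p : ℕ} (hp : p.Prime) {X H : ℝ} (hX : 0 < X) (hH : 0 < H)
    (y : ℝ) :
    |(∑ N ∈ (Finset.Icc ⌈X⌉₊ ⌊X + H⌋₊).filter (fun N => N % 4 ≠ 2), modulusTerm p N) / H -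
      (∑ N ∈ (Finset.Icc ⌈X⌉₊ ⌊X + H⌋₊).filter (fun N => N % 4 ≠ 2), (N.totient : ℝ) / N) / H *
        Real.cos (2 * Real.pi * y)| ≤
      (1 + 2 / H) * (2 * Real.pi * (|(p : ℝ) / X - y| + p / X * (H / X)) + 1 / X) +
        (1 / p + 2 / H) := by
  set E : ℝ := 2 * Real.pi * (|(p : ℝ) / X - y| + p / X * (H / X)) + 1 / X with hE
  have hE0 : 0 ≤ E := by positivity
  set J := Finset.Icc ⌈X⌉₊ ⌊X + H⌋₊ with hJ
  have e : (∑ N ∈ J.filter (fun N => N % 4 ≠ 2), modulusTerm p N) / H -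
      (∑ N ∈ J.filter (fun N => N % 4 ≠ 2), (N.totient : ℝ) / N) / H *
        Real.cos (2 * Real.pi * y) =
      (∑ N ∈ J.filter (fun N => N % 4 ≠ 2),
        (modulusTerm p N - (N.totient : ℝ) / N * Real.cos (2 * Real.pi * y))) / H := by
    rw [Finset.sum_sub_distrib, ← Finset.sum_mul]
    ring
  rw [e, abs_div, abs_of_pos hH, div_le_iff₀ hH]
  have hterm : ∀ N ∈ J, |modulusTerm p N - (N.totient : ℝ) / N * Real.cos (2 * Real.pi * y)| ≤
      E + if p ∣ N then 1 else 0 := by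
    intro N hN
    rw [hJ, Finset.mem_Icc] at hN
    have h1 : X ≤ N := Nat.ceil_le.1 hN.1
    have h2 : (N : ℝ) ≤ X + H := (Nat.le_floor_iff (by linarith)).1 hN.2
    have hN0 : 0 < N := (Nat.ceil_pos.2 hX).trans_le hN.1
    refine (abs_modulusTerm_sub_le hp hN0 y).trans ?_
    rw [hE]
    gcongr
    exact abs_div_sub_le p.cast_nonneg hX h1 h2
  have hc1 := (abs_le.1 (abs_card_dvd_sub_le hX hH.le one_pos)).2
  have hc2 := (abs_le.1 (abs_card_dvd_sub_le hX hH.le hp.pos)).2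
  simp only [one_dvd, Finset.filter_true, Nat.cast_one, div_one] at hc1
  rw [← hJ] at hc1 hc2
  have hp' : (0 : ℝ) < p := by exact_mod_cast hp.pos
  calc _ ≤ ∑ N ∈ J.filter (fun N => N % 4 ≠ 2),
        |modulusTerm p N - (N.totient : ℝ) / N * Real.cos (2 * Real.pi * y)| :=
        Finset.abs_sum_le_sum_abs _ _
    _ ≤ ∑ N ∈ J, |modulusTerm p N - (N.totient : ℝ) / N * Real.cos (2 * Real.pi * y)| :=
        Finset.sum_le_sum_of_subset_of_nonneg (Finset.filter_subset _ _) fun _ _ _ => abs_nonneg _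
    _ ≤ ∑ N ∈ J, (E + if p ∣ N then 1 else 0) := Finset.sum_le_sum hterm
    _ = J.card * E + (J.filter (fun N => p ∣ N)).card := by
        rw [Finset.sum_add_distrib, Finset.sum_const, nsmul_eq_mul, Finset.sum_boole]
    _ ≤ (H + 2) * E + (H / p + 2) := by
        gcongr
        · linarith
        · linarith
    _ = _ := by
        field_simp

lemma tendsto_average_modulusTerm {y δ : ℝ} (hy : 0 < y) (hδ : δ ∈ Set.Ioo (0 : ℝ) 1) :
    Tendsto (fun X : ℝ => (∑ N ∈ (Finset.Icc ⌈X⌉₊ ⌊X + X ^ δ⌋₊).filter (fun N => N % 4 ≠ 2),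
      modulusTerm (leastPrime (y * X)) N) / X ^ δ) atTop
      (𝓝 (5 / Real.pi ^ 2 * Real.cos (2 * Real.pi * y))) := by
  refine tendsto_of_tendsto_of_dist
    ((tendsto_average_totient_div hδ).mul_const (Real.cos (2 * Real.pi * y))) ?_
  have hp := tendsto_leastPrime_div hy
  have hH : Tendsto (fun X : ℝ => 2 / X ^ δ) atTop (𝓝 0) :=
    (tendsto_rpow_atTop hδ.1).const_div_atTop _
  have hX : Tendsto (fun X : ℝ => 1 / X) atTop (𝓝 0) := tendsto_id.const_div_atTop _
  have hHX : Tendsto (fun X : ℝ => X ^ δ / X) atTop (𝓝 0) := by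
    refine (tendsto_rpow_neg_atTop (sub_pos.2 hδ.2)).congr' ?_
    filter_upwards [eventually_gt_atTop 0] with X hX
    rw [neg_sub, Real.rpow_sub_one hX.ne']
  have hp1 : Tendsto (fun X : ℝ => 1 / (leastPrime (y * X) : ℝ)) atTop (𝓝 0) :=
    (tendsto_atTop_mono (fun X => (leastPrime_spec (y * X)).2)
      (tendsto_id.const_mul_atTop hy)).const_div_atTop _
  have hpy : Tendsto (fun X : ℝ => |(leastPrime (y * X) : ℝ) / X - y|) atTop (𝓝 0) := by
    simpa using (hp.sub_const y).abs
  have hlim := ((hH.const_add 1).mul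
    (((hpy.add (hp.mul hHX)).const_mul (2 * Real.pi)).add hX)).add (hp1.add hH)
  simp only [mul_zero, add_zero] at hlim
  refine squeeze_zero' (Eventually.of_forall fun _ => dist_nonneg) ?_ hlim
  filter_upwards [eventually_gt_atTop 0] with X hX
  rw [dist_comm, Real.dist_eq]
  exact abs_average_modulusTerm_sub_le (leastPrime_spec _).1 hX (Real.rpow_pos_of_pos hX δ) y

theorem murmuration_composite_conductors_short (y δ : ℝ) (hy : 0 < y)
    (hδ : δ ∈ Set.Ioo (0 : ℝ) 1) :
    Tendsto (fun X : ℝ => QplusTilde y X δ + EplusTilde y X δ) atTop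
      (𝓝 (Complex.ofReal ((5 / Real.pi ^ 2) * Real.cos (2 * Real.pi * y)))) := by
  refine ((Complex.continuous_ofReal.tendsto _).comp (tendsto_average_modulusTerm hy hδ)).congr' ?_
  filter_upwards [eventually_ge_atTop 2] with X hX
  exact (QplusTilde_add_EplusTilde hX).symm
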